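/- Let λ ∈ X be a dominant integral weight for the type A_r root system, let w ∈ W have reduced word w = s_{i_1}⋯s_{i_k}, and let μ ∈ X satisfy λ − μ ∈ Q and μ ∈ conv{uλ : u ∈ W, u ≤ w}. Then the coefficient of e^μ in the Demazure character D_{i_1}⋯D_{i_k}(e^λ) is nonzero (in fact positive); that is, Demazure characters in type A_r are saturated. -/

import Mathlib

open scoped Classical

/-- Data of a root system with a fixed choice of simple roots: an ambient
`ℚ`-vector space `V`, a set of roots `Φ` with a distinguished subset `pos` of
positive roots, a coroot functional `coroot β = ⟨·, β^∨⟩` for each root, and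
simple roots `α 1, …, α r`. -/
structure RootData where
  r : ℕ
  V : Type
  [grp : AddCommGroup V]
  [mod : Module ℚ V]
  Φ : Set V
  pos : Set V
  coroot : V → Module.Dual ℚ V
  α : Fin r → V

attribute [instance] RootData.grp RootData.mod

namespace RootData

variable (R : RootData)

/-- The group of linear automorphisms of `V`, in which the Weyl group lives. -/
abbrev Aut : Type := R.V ≃ₗ[ℚ] R.V

/-- The linear map `v ↦ v - ⟨v, β^∨⟩ β`. -/
noncomputable def reflMap (β : R.V) : R.V →ₗ[ℚ] R.V :=
  LinearMap.id - (R.coroot β).smulRight β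

/-- The reflection `s_β` associated to a root `β`, as a linear automorphism. -/
noncomputable def s (β : R.V) : R.Aut :=
  if h : (R.reflMap β).comp (R.reflMap β) = LinearMap.id then
    LinearEquiv.ofLinear (R.reflMap β) (R.reflMap β) h h
  else LinearEquiv.refl ℚ R.V

/-- The simple reflections `s_i := s_{α_i}`. -/
noncomputable def S (i : Fin R.r) : R.Aut := R.s (R.α i)

/-- The Weyl group `W`, generated by the simple reflections. -/
noncomputable def weylGroup : Subgroup R.Aut := Subgroup.closure (Set.range R.S)

/-- The product `s_{i_1} ⋯ s_{i_k}` of a word in the simple reflections. -/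
noncomputable def wordProd (l : List (Fin R.r)) : R.Aut := (l.map R.S).prod

/-- The length function on `W`: least length of a word in the simple
reflections expressing the given element. -/
noncomputable def len (w : R.Aut) : ℕ :=
  sInf {n | ∃ l : List (Fin R.r), l.length = n ∧ R.wordProd l = w}

/-- A word is reduced if its length equals the length of its product. -/
def Reduced (l : List (Fin R.r)) : Prop := R.len (R.wordProd l) = l.length

/-- The Bruhat order on `W`: `u ≤ w` iff some reduced word for `w` has a
subword whose product is `u`. -/
def BruhatLE (u w : R.Aut) : Prop :=
  ∃ l : List (Fin R.r), R.Reduced l ∧ R.wordProd l = w ∧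
    ∃ l' : List (Fin R.r), l'.Sublist l ∧ R.wordProd l' = u

/-- Strict Bruhat order. -/
def BruhatLT (u w : R.Aut) : Prop := R.BruhatLE u w ∧ u ≠ w

/-- One step of the Demazure product: `s_i * w := max {w, s_i w}`. -/
noncomputable def dmulStep (i : Fin R.r) (x : R.Aut) : R.Aut :=
  if R.len x < R.len (R.S i * x) then R.S i * x else x

/-- Demazure product of a word in the simple reflections against `w`:
`s_{i_1} * (s_{i_2} * (⋯ * (s_{i_k} * w)))`. -/
noncomputable def dmulList (l : List (Fin R.r)) (w : R.Aut) : R.Aut :=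
  l.foldr R.dmulStep w

/-- The Demazure product `v * w` on the Weyl group, computed by choosing a
reduced word for `v` (it is independent of this choice). -/
noncomputable def dmul (v w : R.Aut) : R.Aut :=
  if h : ∃ l : List (Fin R.r), R.Reduced l ∧ R.wordProd l = v then
    R.dmulList h.choose w
  else v * w

/-- The parabolic subgroup `W_{P_i}` generated by the simple reflections
`s_j`, `j ≠ i`. -/
noncomputable def WPar (i : Fin R.r) : Subgroup R.Aut :=
  Subgroup.closure (R.S '' {j | j ≠ i})

/-- `W^{P_i}`: the set of minimal-length representatives of cosets of
`W/W_{P_i}`. -/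
def minReps (i : Fin R.r) : Set R.Aut :=
  {v | v ∈ R.weylGroup ∧ ∀ p ∈ R.WPar i, R.len v ≤ R.len (v * p)}

/-- `u` is the minimal-length representative of the coset `w W_{P_i}`. -/
def IsMinRep (i : Fin R.r) (u w : R.Aut) : Prop :=
  u ∈ R.minReps i ∧ u⁻¹ * w ∈ R.WPar i

/-- A weight is dominant if it pairs nonnegatively with every simple coroot. -/
def Dominant (lam : R.V) : Prop := ∀ i : Fin R.r, 0 ≤ R.coroot (R.α i) lam

/-- The dual action of the Weyl group on `V* `: `(u f)(v) = f(u⁻¹ v)`. -/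
noncomputable def dualAct (u : R.Aut) (f : Module.Dual ℚ R.V) : Module.Dual ℚ R.V :=
  f.comp (u.symm : R.V →ₗ[ℚ] R.V)

/-- The Demazure polytope `P_λ^w := conv {uλ : u ∈ W, u ≤ w}`. -/
noncomputable def demPolytope (lam : R.V) (w : R.Aut) : Set R.V :=
  convexHull ℚ {m | ∃ u : R.Aut, u ∈ R.weylGroup ∧ R.BruhatLE u w ∧ m = u lam}

/-- Membership in the weight lattice `X`. -/
def IsWeight (lam : R.V) : Prop := ∀ β ∈ R.Φ, ∃ m : ℤ, R.coroot β lam = (m : ℚ)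

/-- The root lattice `Q = ℤΦ`. -/
noncomputable def rootLattice : AddSubgroup R.V := AddSubgroup.closure R.Φ

/-- `w₀` is the longest element of the Weyl group. -/
def IsLongest (w₀ : R.Aut) : Prop :=
  w₀ ∈ R.weylGroup ∧ ∀ g ∈ R.weylGroup, R.len g ≤ R.len w₀

/-- The positive roots `Φ_{P_i}⁺ = Φ⁺ ∩ span {α_j : j ≠ i}` of the standard
Levi subsystem. -/
def parPos (i : Fin R.r) : Set R.V :=
  {η | η ∈ R.pos ∧ η ∈ Submodule.span ℚ (R.α '' {j | j ≠ i})}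

/-- The value `D_i (e^λ)` of the Demazure operator on a basis element of the
group ring `ℤ[X]`. -/
noncomputable def demOnBasis (i : Fin R.r) (lam : R.V) : R.V →₀ ℤ :=
  if 0 ≤ ⌊R.coroot (R.α i) lam⌋ then
    ∑ k ∈ Finset.range (⌊R.coroot (R.α i) lam⌋.toNat + 1),
      Finsupp.single (lam - (k : ℚ) • R.α i) 1
  else if ⌊R.coroot (R.α i) lam⌋ = -1 then 0
  else - ∑ k ∈ Finset.range ((-⌊R.coroot (R.α i) lam⌋).toNat - 1),
      Finsupp.single (lam + ((k : ℚ) + 1) • R.α i) 1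

/-- The Demazure operator `D_i`, as a `ℤ`-linear endomorphism of the group
ring `ℤ[X]` (realized as finitely supported functions `V →₀ ℤ`). -/
noncomputable def demOp (i : Fin R.r) : (R.V →₀ ℤ) →ₗ[ℤ] (R.V →₀ ℤ) :=
  Finsupp.lsum ℤ fun lam => LinearMap.toSpanSingleton ℤ (R.V →₀ ℤ) (R.demOnBasis i lam)

/-- The Demazure character `D_{i_1} ⋯ D_{i_k} (e^λ)`. -/
noncomputable def demChar (l : List (Fin R.r)) (lam : R.V) : R.V →₀ ℤ :=
  l.foldr (fun i p => R.demOp i p) (Finsupp.single lam 1)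

/-- The axioms of a finite crystallographic root system spanning `V`, with
simple roots `α_i` and positive roots `pos`. -/
structure IsRootSystem (R : RootData) : Prop where
  finite : R.Φ.Finite
  span_top : Submodule.span ℚ R.Φ = ⊤
  ne_zero : ∀ β ∈ R.Φ, β ≠ 0
  coroot_self : ∀ β ∈ R.Φ, R.coroot β β = 2
  crystallographic : ∀ β ∈ R.Φ, ∀ γ ∈ R.Φ, ∃ m : ℤ, R.coroot β γ = (m : ℚ)
  reflection_stable : ∀ β ∈ R.Φ, ∀ γ ∈ R.Φ, γ - R.coroot β γ • β ∈ R.Φ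
  simple_mem : ∀ i, R.α i ∈ R.Φ
  indep : LinearIndependent ℚ R.α
  pos_subset : R.pos ⊆ R.Φ
  pos_or_neg : ∀ β ∈ R.Φ, (β ∈ R.pos ∧ -β ∉ R.pos) ∨ (β ∉ R.pos ∧ -β ∈ R.pos)
  simple_pos : ∀ i, R.α i ∈ R.pos
  pos_nonneg_comb : ∀ β ∈ R.pos, ∃ c : Fin R.r → ℚ, (∀ i, 0 ≤ c i) ∧ β = ∑ i, c i • R.α i

end RootData

/-- The "dot product with `β`" linear functional on `ℚ^n`. -/
noncomputable def dotL {n : ℕ} (β : Fin n → ℚ) : Module.Dual ℚ (Fin n → ℚ) :=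
  ∑ a, β a • LinearMap.proj a

/-- The coroot functional `⟨·, β^∨⟩ = 2(β,·)/(β,β)` for the standard inner
product on `ℚ^n`. -/
noncomputable def stdCoroot {n : ℕ} (β : Fin n → ℚ) : Module.Dual ℚ (Fin n → ℚ) :=
  (2 / dotL β β) • dotL β

/-- The root system of type `A_r` inside `ℚ^{r+1}`:
roots `e_a - e_b` (`a ≠ b`), simple roots `α_i = e_i - e_{i+1}`. -/
noncomputable def typeA (r : ℕ) : RootData where
  r := r
  V := Fin (r + 1) → ℚ
  Φ := {v | ∃ a b : Fin (r + 1), a ≠ b ∧ v = Pi.single a 1 - Pi.single b 1}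
  pos := {v | ∃ a b : Fin (r + 1), a < b ∧ v = Pi.single a 1 - Pi.single b 1}
  coroot := stdCoroot
  α := fun i => Pi.single i.castSucc 1 - Pi.single i.succ 1

/-- The root system of type `B_r` inside `ℚ^r`: roots `±e_a`, `±e_a ± e_b`. -/
noncomputable def typeB (r : ℕ) : RootData where
  r := r
  V := Fin r → ℚ
  Φ := {v | (∃ a : Fin r, v = Pi.single a 1 ∨ v = -Pi.single a 1) ∨
      ∃ a b : Fin r, a < b ∧ (v = Pi.single a 1 - Pi.single b 1 ∨
        v = Pi.single a 1 + Pi.single b 1 ∨ v = -(Pi.single a 1 - Pi.single b 1) ∨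
        v = -(Pi.single a 1 + Pi.single b 1))}
  pos := {v | (∃ a : Fin r, v = Pi.single a 1) ∨
      ∃ a b : Fin r, a < b ∧ (v = Pi.single a 1 - Pi.single b 1 ∨
        v = Pi.single a 1 + Pi.single b 1)}
  coroot := stdCoroot
  α := fun i => if h : (i : ℕ) + 1 < r then
      Pi.single i 1 - Pi.single (⟨(i : ℕ) + 1, h⟩ : Fin r) 1
    else Pi.single i (1 : ℚ)

/-- The root system of type `C_r` inside `ℚ^r`: roots `±2e_a`, `±e_a ± e_b`. -/
noncomputable def typeC (r : ℕ) : RootData where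
  r := r
  V := Fin r → ℚ
  Φ := {v | (∃ a : Fin r, v = Pi.single a (2 : ℚ) ∨ v = -(Pi.single a (2 : ℚ))) ∨
      ∃ a b : Fin r, a < b ∧ (v = Pi.single a 1 - Pi.single b 1 ∨
        v = Pi.single a 1 + Pi.single b 1 ∨ v = -(Pi.single a 1 - Pi.single b 1) ∨
        v = -(Pi.single a 1 + Pi.single b 1))}
  pos := {v | (∃ a : Fin r, v = Pi.single a (2 : ℚ)) ∨
      ∃ a b : Fin r, a < b ∧ (v = Pi.single a 1 - Pi.single b 1 ∨
        v = Pi.single a 1 + Pi.single b 1)}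
  coroot := stdCoroot
  α := fun i => if h : (i : ℕ) + 1 < r then
      Pi.single i 1 - Pi.single (⟨(i : ℕ) + 1, h⟩ : Fin r) 1
    else Pi.single i (2 : ℚ)

/-- The root system of type `D_r` inside `ℚ^r`: roots `±e_a ± e_b` (`a < b`). -/
noncomputable def typeD (r : ℕ) : RootData where
  r := r
  V := Fin r → ℚ
  Φ := {v | ∃ a b : Fin r, a < b ∧ (v = Pi.single a 1 - Pi.single b 1 ∨
        v = Pi.single a 1 + Pi.single b 1 ∨ v = -(Pi.single a 1 - Pi.single b 1) ∨
        v = -(Pi.single a 1 + Pi.single b 1))}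
  pos := {v | ∃ a b : Fin r, a < b ∧ (v = Pi.single a 1 - Pi.single b 1 ∨
        v = Pi.single a 1 + Pi.single b 1)}
  coroot := stdCoroot
  α := fun i => if h : (i : ℕ) + 1 < r then
      Pi.single i 1 - Pi.single (⟨(i : ℕ) + 1, h⟩ : Fin r) 1
    else if h2 : 1 < r then
      Pi.single (⟨r - 2, by omega⟩ : Fin r) 1 + Pi.single (⟨r - 1, by omega⟩ : Fin r) 1
    else 0

open AddMonoidAlgebra (single)

/-- The descending word `j + d - 1, …, j + 1, j`. -/
def descWord (j : ℕ) : ℕ → List ℕ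
  | 0 => []
  | d + 1 => (j + d) :: descWord j d

/-- The concatenation of the descending words `m, m - 1, …, c m` for `m < n`. -/
def normalWord (c : ℕ → ℕ) : ℕ → List ℕ
  | 0 => []
  | n + 1 => normalWord c n ++ descWord (c n) (n + 1 - c n)

/-- The commutation and braid relations of type `A`. -/
structure IsBraidFamily {M : Type*} [Monoid M] (T : ℕ → M) : Prop where
  comm : ∀ i j, i + 2 ≤ j → T i * T j = T j * T i
  braid : ∀ i, T i * T (i + 1) * T i = T (i + 1) * T i * T (i + 1)

/-- Two words are braid equivalent if they have the same value on every braid family. -/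
def BraidEq (l l' : List ℕ) : Prop :=
  ∀ (M : Type) [Monoid M] (T : ℕ → M), IsBraidFamily T → (l.map T).prod = (l'.map T).prod

lemma mem_descWord {j d x : ℕ} : x ∈ descWord j d ↔ j ≤ x ∧ x < j + d := by
  induction d with
  | zero => simp [descWord]
  | succ d ih => simp [descWord, ih]; omega

lemma mem_normalWord_lt {c : ℕ → ℕ} {n x : ℕ} (hc : ∀ m, c m ≤ m + 1)
    (h : x ∈ normalWord c n) : x < n := by
  induction n with
  | zero => simp [normalWord] at h
  | succ n ih =>
    simp only [normalWord, List.mem_append, mem_descWord] at h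
    have := hc n
    rcases h with h | h
    · have := ih h; omega
    · omega

lemma normalWord_congr {c c' : ℕ → ℕ} {n : ℕ} (h : ∀ m < n, c m = c' m) :
    normalWord c n = normalWord c' n := by
  induction n with
  | zero => rfl
  | succ n ih =>
    simp only [normalWord]
    rw [ih fun m hm => h m (by omega), h n (by omega)]

namespace IsBraidFamily

variable {M : Type*} [Monoid M] {T : ℕ → M}

lemma mul_prod_comm (hT : IsBraidFamily T) {i : ℕ} {l : List ℕ}
    (h : ∀ x ∈ l, x + 2 ≤ i ∨ i + 2 ≤ x) : T i * (l.map T).prod = (l.map T).prod * T i := by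
  induction l with
  | nil => simp
  | cons a l ih =>
    have h1 : T i * T a = T a * T i := by
      rcases h a (by simp) with h | h
      · exact (hT.comm _ _ h).symm
      · exact hT.comm _ _ h
    simp only [List.map_cons, List.prod_cons]
    rw [← mul_assoc, h1, mul_assoc, ih fun x hx => h x (by simp [hx]), mul_assoc]

lemma mul_descWord (hT : IsBraidFamily T) {i j d : ℕ} (h1 : j ≤ i) (h2 : i + 1 < j + d) :
    T i * ((descWord j d).map T).prod = ((descWord j d).map T).prod * T (i + 1) := by
  induction d with
  | zero => omega
  | succ d ih =>
    simp only [descWord, List.map_cons, List.prod_cons]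
    by_cases h : i + 1 < j + d
    · rw [← mul_assoc, hT.comm i (j + d) (by omega), mul_assoc, ih h, mul_assoc]
    · obtain ⟨e, rfl⟩ : ∃ e, d = e + 1 := ⟨d - 1, by omega⟩
      obtain rfl : i = j + e := by omega
      simp only [descWord, List.map_cons, List.prod_cons]
      have h3 : T (j + e + 1) * ((descWord j e).map T).prod
          = ((descWord j e).map T).prod * T (j + e + 1) :=
        hT.mul_prod_comm fun x hx => by rw [mem_descWord] at hx; omega
      have h4 := hT.braid (j + e)
      rw [← add_assoc]
      calc _ = (T (j + e) * T (j + e + 1) * T (j + e)) * ((descWord j e).map T).prod := by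
            simp only [mul_assoc]
        _ = T (j + e + 1) * T (j + e) * (T (j + e + 1) * ((descWord j e).map T).prod) := by
            rw [h4]; simp only [mul_assoc]
        _ = _ := by rw [h3]; simp only [mul_assoc]

lemma descWord_mul_descWord (hT : IsBraidFamily T) {a e j d : ℕ} (h1 : j ≤ a)
    (h2 : a + e < j + d) :
    ((descWord a e).map T).prod * ((descWord j d).map T).prod
      = ((descWord j d).map T).prod * ((descWord (a + 1) e).map T).prod := by
  induction e with
  | zero => simp [descWord]
  | succ e ih =>
    simp only [descWord, List.map_cons, List.prod_cons]
    rw [mul_assoc, ih (by omega), ← mul_assoc, hT.mul_descWord (by omega) (by omega), mul_assoc,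
      add_right_comm]

end IsBraidFamily

/-- Left multiplication of a normal word by a letter either yields, up to braid equivalence,
another normal word, or the letter is a left descent of the normal word. -/
lemma cons_normalWord {n i : ℕ} (hi : i < n) {c : ℕ → ℕ} (hc : ∀ m, c m ≤ m + 1) :
    (∃ c' : ℕ → ℕ, (∀ m, c' m ≤ m + 1) ∧ BraidEq (i :: normalWord c n) (normalWord c' n)) ∨
    (∃ l' : List ℕ, (∀ x ∈ l', x < n) ∧ BraidEq (normalWord c n) (i :: l')) := by
  induction n with
  | zero => omega
  | succ n ih =>
    rcases Nat.lt_or_ge i n with hin | hin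
    · rcases ih hin with ⟨c', hc', h⟩ | ⟨l', hl', h⟩
      · refine .inl ⟨Function.update c' n (c n), fun m => ?_, fun M _ T hT => ?_⟩
        · by_cases hm : m = n
          · subst hm; simpa using hc m
          · simpa [Function.update_of_ne hm] using hc' m
        · have := h M T hT
          simp only [normalWord, List.map_cons, List.prod_cons, List.map_append, List.prod_append,
            Function.update_self] at this ⊢
          rw [← mul_assoc, this, normalWord_congr (c := Function.update c' n (c n)) (c' := c')]
          intro m hm
          rw [Function.update_of_ne hm.ne]
      · refine .inr ⟨l' ++ descWord (c n) (n + 1 - c n), fun x hx => ?_, fun M _ T hT => ?_⟩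
        · have := hc n
          rw [List.mem_append, mem_descWord] at hx
          rcases hx with hx | hx
          · have := hl' x hx; omega
          · omega
        · have := h M T hT
          simp only [normalWord, List.map_cons, List.prod_cons, List.map_append,
            List.prod_append] at this ⊢
          rw [this, mul_assoc]
    · obtain rfl : i = n := by omega
      rcases i with _ | p
      · have h0 := hc 0
        rcases Nat.eq_zero_or_pos (c 0) with h | h
        · exact .inr ⟨[], by simp, fun M _ T _ => by simp [normalWord, h, descWord]⟩
        · refine .inl ⟨fun _ => 0, by simp, fun M _ T _ => ?_⟩
          have : c 0 = 1 := by omega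
          simp [normalWord, this, descWord]
      · have hk := hc p
        have hj := hc (p + 1)
        have hcomm : ∀ (M : Type) [Monoid M] (T : ℕ → M), IsBraidFamily T →
            T (p + 1) * ((normalWord c p).map T).prod
              = ((normalWord c p).map T).prod * T (p + 1) := fun M _ T hT =>
          hT.mul_prod_comm fun x hx => by have := mem_normalWord_lt hc hx; omega
        rcases Nat.lt_or_ge (c p) (c (p + 1)) with hkj | hkj
        · refine .inl ⟨Function.update (Function.update c p (c (p + 1) - 1)) (p + 1) (c p),
            fun m => ?_, fun M _ T hT => ?_⟩
          · simp only [Function.update_apply]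
            split_ifs <;> first | omega | exact hc m
          · simp only [normalWord, List.map_cons, List.prod_cons, List.map_append,
              List.prod_append, Function.update_self]
            rw [Function.update_of_ne (by omega), Function.update_self,
              normalWord_congr (c := Function.update _ _ _) (c' := c)]
            · have e1 : T (p + 1) * ((descWord (c p) (p + 1 - c p)).map T).prod
                  = ((descWord (c p) (p + 1 + 1 - c p)).map T).prod := by
                obtain ⟨d, hd⟩ : ∃ d, p + 1 = c p + d := ⟨p + 1 - c p, by omega⟩
                rw [show p + 1 + 1 - c p = d + 1 by omega, show p + 1 - c p = d by omega]
                simp [descWord, hd]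
              have e2 := hT.descWord_mul_descWord (a := c (p + 1) - 1) (e := p + 1 + 1 - c (p + 1))
                (j := c p) (d := p + 1 + 1 - c p) (by omega) (by omega)
              rw [show c (p + 1) - 1 + 1 = c (p + 1) by omega] at e2
              rw [show p + 1 - (c (p + 1) - 1) = p + 1 + 1 - c (p + 1) by omega, mul_assoc,
                mul_assoc,
                e2, ← e1, ← mul_assoc, hcomm M T hT]
              simp only [mul_assoc]
            · intro m hm
              rw [Function.update_of_ne (by omega), Function.update_of_ne (by omega)]
        · refine .inr ⟨normalWord c p ++ (descWord (c (p + 1)) (p + 1 - c (p + 1)) ++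
            descWord (c p + 1) (p + 1 - c p)), fun x hx => ?_, fun M _ T hT => ?_⟩
          · rw [List.mem_append, List.mem_append, mem_descWord, mem_descWord] at hx
            rcases hx with hx | hx | hx
            · have := mem_normalWord_lt hc hx; omega
            · omega
            · omega
          · simp only [normalWord, List.map_cons, List.prod_cons, List.map_append,
              List.prod_append]
            have e1 : T (p + 1) * ((descWord (c (p + 1)) (p + 1 - c (p + 1))).map T).prod
                = ((descWord (c (p + 1)) (p + 1 + 1 - c (p + 1))).map T).prod := by
              obtain ⟨d, hd⟩ : ∃ d, p + 1 = c (p + 1) + d := ⟨p + 1 - c (p + 1), by omega⟩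
              rw [show p + 1 + 1 - c (p + 1) = d + 1 by omega,
                show p + 1 - c (p + 1) = d by omega]
              simp [descWord, ← hd]
            have e2 := hT.descWord_mul_descWord (a := c p) (e := p + 1 - c p)
                (j := c (p + 1)) (d := p + 1 + 1 - c (p + 1)) (by omega) (by omega)
            rw [mul_assoc, e2, ← e1, ← mul_assoc, ← mul_assoc, ← mul_assoc, ← mul_assoc,
              hcomm M T hT]

/-- Every word agrees with some normal word on all idempotent braid families. -/
lemma exists_normalWord_of_idempotent {M : Type} [Monoid M] {T : ℕ → M} (hT : IsBraidFamily T)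
    (hid : ∀ i, T i * T i = T i) {n : ℕ} {l : List ℕ} (hl : ∀ x ∈ l, x < n) :
    ∃ c : ℕ → ℕ, (∀ m, c m ≤ m + 1) ∧ (l.map T).prod = ((normalWord c n).map T).prod := by
  induction l with
  | nil =>
    refine ⟨fun m => m + 1, fun _ => le_rfl, ?_⟩
    have : normalWord (fun m => m + 1) n = [] := by
      induction n with
      | zero => rfl
      | succ n ih => simpa [normalWord, descWord] using ih
    simp [this]
  | cons i l ih =>
    obtain ⟨c, hc, h⟩ := ih fun x hx => hl x (by simp [hx])
    rcases cons_normalWord (hl i (by simp)) hc with ⟨c', hc', h'⟩ | ⟨l', -, h'⟩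
    · exact ⟨c', hc', by rw [← h' M T hT]; simp [h]⟩
    · refine ⟨c, hc, ?_⟩
      have := h' M T hT
      simp only [List.map_cons, List.prod_cons] at this ⊢
      rw [h, this, ← mul_assoc, hid]

lemma BraidEq.length_eq {l l' : List ℕ} (h : BraidEq l l') : l.length = l'.length := by
  have := h (Multiplicative ℕ) (fun _ => Multiplicative.ofAdd 1)
    ⟨fun _ _ _ => rfl, fun _ => rfl⟩
  simpa using this

/-- The adjacent transposition `(i, i + 1)` of `ℕ`. -/
def adjSwap (i : ℕ) : Equiv.Perm ℕ := Equiv.swap i (i + 1)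

lemma isBraidFamily_adjSwap : IsBraidFamily adjSwap where
  comm i j h := by
    ext x
    simp only [adjSwap, Equiv.Perm.mul_apply, Equiv.swap_apply_def]
    split_ifs <;> omega
  braid i := by
    ext x
    simp only [adjSwap, Equiv.Perm.mul_apply, Equiv.swap_apply_def]
    split_ifs <;> omega

/-- The permutation of `ℕ` represented by a word. -/
def wordPerm (l : List ℕ) : Equiv.Perm ℕ := (l.map adjSwap).prod

lemma wordPerm_cons (i : ℕ) (l : List ℕ) : wordPerm (i :: l) = adjSwap i * wordPerm l := by
  simp [wordPerm]

lemma wordPerm_append (l l' : List ℕ) : wordPerm (l ++ l') = wordPerm l * wordPerm l' := by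
  simp [wordPerm]

lemma wordPerm_apply_of_lt {l : List ℕ} {n x : ℕ} (hl : ∀ y ∈ l, y < n) (hx : n < x) :
    wordPerm l x = x := by
  induction l with
  | nil => rfl
  | cons i l ih =>
    have := hl i (by simp)
    rw [wordPerm_cons, Equiv.Perm.mul_apply, ih fun y hy => hl y (by simp [hy])]
    exact Equiv.swap_apply_of_ne_of_ne (by omega) (by omega)

lemma wordPerm_descWord (j d : ℕ) : wordPerm (descWord j d) j = j + d := by
  induction d with
  | zero => rfl
  | succ d ih =>
    rw [descWord, wordPerm_cons, Equiv.Perm.mul_apply, ih]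
    exact Equiv.swap_apply_left _ _

lemma normalWord_injective {c c' : ℕ → ℕ} {n : ℕ} (hc : ∀ m, c m ≤ m + 1)
    (hc' : ∀ m, c' m ≤ m + 1) (h : wordPerm (normalWord c n) = wordPerm (normalWord c' n)) :
    normalWord c n = normalWord c' n := by
  induction n with
  | zero => rfl
  | succ n ih =>
    have key : ∀ c : ℕ → ℕ, (∀ m, c m ≤ m + 1) → wordPerm (normalWord c (n + 1)) (c n) = n + 1 := by
      intro c hc
      have := hc n
      rw [normalWord, wordPerm_append, Equiv.Perm.mul_apply, wordPerm_descWord,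
        Nat.add_sub_cancel' this]
      exact wordPerm_apply_of_lt (fun y hy => mem_normalWord_lt hc hy) (by omega)
    have e : c n = c' n := by
      apply (wordPerm (normalWord c (n + 1))).injective
      rw [key c hc, h, key c' hc']
    rw [normalWord, normalWord, e] at h ⊢
    rw [wordPerm_append, wordPerm_append] at h
    rw [ih (mul_right_cancel h)]

/-- A word is reduced, in terms of permutations, among the words with letters below `n`. -/
def IsShortest (n : ℕ) (l : List ℕ) : Prop :=
  ∀ l' : List ℕ, (∀ x ∈ l', x < n) → wordPerm l' = wordPerm l → l.length ≤ l'.length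

lemma IsShortest.of_cons {n i : ℕ} {l : List ℕ} (hi : i < n) (h : IsShortest n (i :: l)) :
    IsShortest n l := by
  intro l' hl' e
  have := h (i :: l') (by simpa [hi] using hl') (by rw [wordPerm_cons, wordPerm_cons, e])
  simpa using this

lemma IsShortest.braidEq_normalWord {n : ℕ} {l : List ℕ} (hl : ∀ x ∈ l, x < n)
    (h : IsShortest n l) :
    ∃ c : ℕ → ℕ, (∀ m, c m ≤ m + 1) ∧ BraidEq l (normalWord c n) := by
  induction l with
  | nil =>
    refine ⟨fun m => m + 1, fun _ => le_rfl, ?_⟩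
    have : normalWord (fun m => m + 1) n = [] := by
      induction n with
      | zero => rfl
      | succ n ih => simpa [normalWord, descWord] using ih (by simp) (by simp [IsShortest])
    rw [this]
    exact fun M _ T _ => rfl
  | cons i l ih =>
    have hi := hl i (by simp)
    obtain ⟨c, hc, hw⟩ := ih (fun x hx => hl x (by simp [hx])) (h.of_cons hi)
    rcases cons_normalWord hi hc with ⟨c', hc', h'⟩ | ⟨l', hl', h'⟩
    · refine ⟨c', hc', fun M _ T hT => ?_⟩
      rw [← h' M T hT, List.map_cons, List.map_cons, List.prod_cons, List.prod_cons, hw M T hT]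
    · exfalso
      have e1 : wordPerm l = adjSwap i * wordPerm l' := by
        rw [← wordPerm_cons]
        exact (hw _ _ isBraidFamily_adjSwap).trans (h' _ _ isBraidFamily_adjSwap)
      have e2 := h l' hl' (by
        rw [wordPerm_cons, e1, ← mul_assoc, adjSwap, Equiv.swap_mul_self, one_mul])
      have e3 := hw.length_eq
      have e4 := h'.length_eq
      simp only [List.length_cons] at e2 e4
      omega

/-- Two shortest words of the same permutation are braid equivalent. -/
lemma IsShortest.braidEq {n : ℕ} {l l' : List ℕ} (hl : ∀ x ∈ l, x < n) (hl' : ∀ x ∈ l', x < n)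
    (h : IsShortest n l) (h' : IsShortest n l') (e : wordPerm l = wordPerm l') :
    BraidEq l l' := by
  obtain ⟨c, hc, hw⟩ := h.braidEq_normalWord hl
  obtain ⟨c', hc', hw'⟩ := h'.braidEq_normalWord hl'
  have : normalWord c n = normalWord c' n := by
    apply normalWord_injective hc hc'
    have h1 := hw _ _ isBraidFamily_adjSwap
    have h2 := hw' _ _ isBraidFamily_adjSwap
    exact h1.symm.trans (e.trans h2)
  intro M _ T hT
  rw [hw M T hT, this, hw' M T hT]

section DemazureOperator

variable {V : Type} [AddCommGroup V]

/-- The value of the Demazure operator of a root `α` with coroot `φ` on `e^v`. -/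
noncomputable def demSum (α : V) (φ : V →+ ℤ) (v : V) : AddMonoidAlgebra ℤ V :=
  if 0 ≤ φ v then ∑ k ∈ Finset.range ((φ v).toNat + 1), single (v - k • α) 1
  else -∑ k ∈ Finset.range ((-φ v).toNat - 1), single (v + (k + 1) • α) 1

/-- The Demazure operator of a root `α` with coroot `φ` on the group ring of `V`. -/
noncomputable def dem (α : V) (φ : V →+ ℤ) : AddMonoid.End (AddMonoidAlgebra ℤ V) :=
  (Finsupp.liftAddHom fun v => zmultiplesHom (AddMonoidAlgebra ℤ V) (demSum α φ v)).comp
    AddMonoidAlgebra.coeffAddEquiv.toAddMonoidHom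

lemma dem_single (α : V) (φ : V →+ ℤ) (v : V) : dem α φ (single v 1) = demSum α φ v := by
  change (Finsupp.liftAddHom fun v => zmultiplesHom (AddMonoidAlgebra ℤ V) (demSum α φ v))
    (AddMonoidAlgebra.coeff (single v 1)) = _
  rw [AddMonoidAlgebra.coeff_single]
  simp

lemma groupRing_hom_ext {A : Type*} [AddCommGroup A] {f g : AddMonoidAlgebra ℤ V →+ A}
    (h : ∀ v, f (single v 1) = g (single v 1)) : f = g := by
  refine AddMonoidAlgebra.addMonoidHom_ext fun v n => ?_
  have e : (single v n : AddMonoidAlgebra ℤ V) = n • single v 1 := by simp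
  rw [e, map_zsmul, map_zsmul, h]

/-- The reflection `v ↦ v - ⟨v, φ⟩ α`. -/
def reflHom (α : V) (φ : V →+ ℤ) : V →+ V :=
  AddMonoidHom.mk' (fun v => v - φ v • α) fun a b => by
    simp only [map_add, add_smul]; abel

lemma reflHom_apply (α : V) (φ : V →+ ℤ) (v : V) : reflHom α φ v = v - φ v • α := rfl

/-- The action of a reflection on the group ring. -/
noncomputable def reflRing (α : V) (φ : V →+ ℤ) :
    AddMonoidAlgebra ℤ V →+* AddMonoidAlgebra ℤ V :=
  AddMonoidAlgebra.mapDomainRingHom ℤ (reflHom α φ)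

lemma reflRing_single (α : V) (φ : V →+ ℤ) (v : V) :
    reflRing α φ (single v 1) = single (v - φ v • α) 1 := by
  simp [reflRing, reflHom_apply]

lemma one_sub_mul_sum_range (α v : V) (n : ℕ) :
    (1 - single (-α) 1 : AddMonoidAlgebra ℤ V) * ∑ k ∈ Finset.range n, single (v - k • α) 1
      = single v 1 - single (v - n • α) 1 := by
  induction n with
  | zero => simp
  | succ n ih =>
    rw [Finset.sum_range_succ, mul_add, ih, sub_mul, one_mul, AddMonoidAlgebra.single_mul_single,
      show -α + (v - n • α) = v - (n + 1) • α by rw [add_smul, one_smul]; abel, mul_one]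
    abel

lemma one_sub_mul_dem (α : V) (φ : V →+ ℤ) (f : AddMonoidAlgebra ℤ V) :
    (1 - single (-α) 1) * dem α φ f = f - single (-α) 1 * reflRing α φ f := by
  suffices h : (AddMonoidHom.mulLeft (1 - single (-α) 1 : AddMonoidAlgebra ℤ V)).comp (dem α φ)
      = AddMonoidHom.id _ - (AddMonoidHom.mulLeft (single (-α) 1)).comp
        (reflRing α φ).toAddMonoidHom from DFunLike.congr_fun h f
  refine groupRing_hom_ext fun v => ?_
  change (1 - single (-α) 1) * dem α φ (single v 1)
    = single v 1 - single (-α) 1 * reflRing α φ (single v 1)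
  rw [dem_single, reflRing_single, AddMonoidAlgebra.single_mul_single, mul_one, demSum]
  split_ifs with h
  · rw [one_sub_mul_sum_range]
    congr 2
    obtain ⟨n, hn⟩ := Int.eq_ofNat_of_zero_le h
    rw [hn, Int.toNat_natCast, add_smul, one_smul, natCast_zsmul]
    abel
  · obtain ⟨n, hn⟩ : ∃ n : ℕ, φ v = -(n + 1 : ℤ) := ⟨(-φ v - 1).toNat, by omega⟩
    have e : ∑ k ∈ Finset.range ((-φ v).toNat - 1),
          (single (v + (k + 1) • α) 1 : AddMonoidAlgebra ℤ V)
        = ∑ k ∈ Finset.range n, single ((v + n • α) - k • α) 1 := by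
      rw [show (-φ v).toNat - 1 = n by omega, ← Finset.sum_range_reflect]
      refine Finset.sum_congr rfl fun k hk => ?_
      have hk := Finset.mem_range.1 hk
      congr 1
      obtain ⟨m, rfl⟩ : ∃ m, n = m + k + 1 := ⟨n - k - 1, by omega⟩
      rw [show m + k + 1 - 1 - k + 1 = m + 1 by omega]
      simp only [add_smul, one_smul]
      abel
    rw [e, mul_neg, one_sub_mul_sum_range, hn, neg_sub]
    congr 2
    · abel
    · rw [neg_smul, add_smul, one_smul, natCast_zsmul]
      abel

end DemazureOperator

section RingIdentities

variable {R : Type*} [CommRing R] [IsDomain R] (s t : R →+* R) (a b : R) (D E : R → R)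

lemma divided_braid_expand (ha : 1 - a ≠ 0) (hs : ∀ f, s (s f) = f)
    (hsa : s a * a = 1) (hsb : s b = a * b) (hta : t a = a * b)
    (hD : ∀ f, (1 - a) * D f = f - a * s f) (hE : ∀ f, (1 - b) * E f = f - b * t f) (f : R) :
    (1 - a) * (1 - b) * (1 - a * b) * D (E (D f)) =
      f - a * s f - b * t f + a * b ^ 2 * t (s f) + a ^ 2 * b * s (t f)
        - a ^ 2 * b ^ 2 * s (t (s f)) := by
  have h1 := hD f
  have h2 := hE (D f)
  have h3 := hD (E (D f))
  have h4 := congrArg t h1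
  have h5 := congrArg s h2
  have h6 := congrArg s h1
  have h7 := congrArg s h4
  simp only [map_mul, map_sub, map_one, hta, hsb, hs] at h4 h5 h6 h7
  apply mul_left_cancel₀ ha
  generalize D (E (D f)) = x3 at *
  generalize s (E (D f)) = sx2 at *
  generalize E (D f) = x2 at *
  generalize s (t (D f)) = stx1 at *
  generalize t (D f) = tx1 at *
  generalize s (D f) = sx1 at *
  generalize D f = x1 at *
  generalize s (t (s f)) = stsf at *
  generalize s (t f) = stf at *
  generalize t (s f) = tsf at *
  generalize t f = tf at *
  generalize s f = sf at *
  generalize s a = a' at *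
  have g6 : (1 - a) * sx1 = f - a * sf := by linear_combination -a * h6 + (f - sx1) * hsa
  have g7 : (1 - b) * stx1 = stf - b * stsf := by
    linear_combination h7 + b * (stx1 - stsf) * hsa
  have g5 : (1 - a * b) * sx2 = sx1 - a * b * stx1 := by linear_combination h5
  linear_combination (1 - a) * (1 - b) * (1 - a * b) * h3
    + (1 - a) * (1 - a * b) * h2 + (1 - a * b) * h1 - b * (1 - a) * h4
    - a * (1 - a) * (1 - b) * g5 - a * (1 - b) * g6 + a ^ 2 * b * (1 - a) * g7

lemma divided_braid (ha : 1 - a ≠ 0) (hb : 1 - b ≠ 0) (hab : 1 - a * b ≠ 0)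
    (hs : ∀ f, s (s f) = f) (ht : ∀ f, t (t f) = f) (hst : ∀ f, s (t (s f)) = t (s (t f)))
    (hsa : s a * a = 1) (htb : t b * b = 1) (hsb : s b = a * b) (hta : t a = a * b)
    (hD : ∀ f, (1 - a) * D f = f - a * s f) (hE : ∀ f, (1 - b) * E f = f - b * t f) (f : R) :
    D (E (D f)) = E (D (E f)) := by
  have h1 := divided_braid_expand s t a b D E ha hs hsa hsb hta hD hE f
  have h2 := divided_braid_expand t s b a E D hb ht htb (by rw [hta, mul_comm])
    (by rw [hsb, mul_comm]) hE hD f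
  apply mul_left_cancel₀ (mul_ne_zero (mul_ne_zero ha hb) hab)
  linear_combination h1 - h2 - a ^ 2 * b ^ 2 * hst f

lemma divided_comm (ha : 1 - a ≠ 0) (hb : 1 - b ≠ 0) (hst : ∀ f, s (t f) = t (s f))
    (hsb : s b = b) (hta : t a = a)
    (hD : ∀ f, (1 - a) * D f = f - a * s f) (hE : ∀ f, (1 - b) * E f = f - b * t f) (f : R) :
    D (E f) = E (D f) := by
  have h1 := hD (E f)
  have h2 := hE f
  have h3 := hE (D f)
  have h4 := hD f
  have h5 := congrArg s h2
  have h6 := congrArg t h4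
  simp only [map_mul, map_sub, map_one, hta, hsb] at h5 h6
  apply mul_left_cancel₀ (mul_ne_zero ha hb)
  linear_combination (1 - b) * h1 + h2 - a * h5 - (1 - a) * h3 - h4 + b * h6 + a * b * hst f

lemma divided_idem (ha : 1 - a ≠ 0) (hs : ∀ f, s (s f) = f) (hsa : s a * a = 1)
    (hD : ∀ f, (1 - a) * D f = f - a * s f) (f : R) : D (D f) = D f := by
  have h1 := hD (D f)
  have h2 := hD f
  have h3 := congrArg s h2
  simp only [map_mul, map_sub, map_one, hs] at h3
  have h4 : s (D f) = D f := by
    apply mul_left_cancel₀ ha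
    linear_combination -a * h3 - h2 + (f - s (D f)) * hsa
  apply mul_left_cancel₀ ha
  rw [h1, h4]; ring

end RingIdentities

section Relations

variable {V : Type} [AddCommGroup V] {α : ℕ → V} {φ : ℕ → V →+ ℤ}

/-- A family of roots and coroots pairing as in the Cartan matrix of type `A_∞`. -/
structure IsTypeA (α : ℕ → V) (φ : ℕ → V →+ ℤ) : Prop where
  self : ∀ i, φ i (α i) = 2
  succ_left : ∀ i, φ (i + 1) (α i) = -1
  succ_right : ∀ i, φ i (α (i + 1)) = -1
  far_left : ∀ i j, i + 2 ≤ j → φ i (α j) = 0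
  far_right : ∀ i j, i + 2 ≤ j → φ j (α i) = 0

lemma one_sub_single_ne_zero {v : V} (hv : v ≠ 0) :
    (1 - single v 1 : AddMonoidAlgebra ℤ V) ≠ 0 := by
  intro h
  rw [sub_eq_zero, AddMonoidAlgebra.one_def] at h
  have h := congrArg AddMonoidAlgebra.coeff h
  simp only [AddMonoidAlgebra.coeff_single] at h
  exact hv (Finsupp.single_left_injective (one_ne_zero) h).symm

namespace IsTypeA

lemma root_ne_zero (h : IsTypeA α φ) (i : ℕ) : -α i ≠ 0 := by
  intro h0
  have := h.self i
  rw [neg_eq_zero.1 h0] at this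
  simp at this

lemma reflRing_reflRing (h : IsTypeA α φ) (i : ℕ) (f : AddMonoidAlgebra ℤ V) :
    reflRing (α i) (φ i) (reflRing (α i) (φ i) f) = f := by
  suffices e : ((reflRing (α i) (φ i)).comp (reflRing (α i) (φ i))).toAddMonoidHom
      = AddMonoidHom.id _ from DFunLike.congr_fun e f
  refine groupRing_hom_ext fun v => ?_
  change reflRing (α i) (φ i) (reflRing (α i) (φ i) (single v 1)) = single v 1
  rw [reflRing_single, reflRing_single]
  congr 1
  rw [map_sub, map_zsmul, h.self, smul_eq_mul, sub_smul, mul_comm, mul_smul, two_smul ℤ]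
  abel

lemma reflRing_mul_self (h : IsTypeA α φ) (i : ℕ) :
    reflRing (α i) (φ i) (single (-α i) 1) * single (-α i) 1 = 1 := by
  rw [reflRing_single, AddMonoidAlgebra.single_mul_single, AddMonoidAlgebra.one_def, map_neg,
    h.self, neg_smul, two_smul ℤ, mul_one]
  congr 1
  abel

variable [UniqueSums V]

lemma dem_idem (h : IsTypeA α φ) (i : ℕ) :
    dem (α i) (φ i) * dem (α i) (φ i) = dem (α i) (φ i) := by
  ext1 f
  exact divided_idem (reflRing (α i) (φ i)) _ (dem (α i) (φ i))
    (one_sub_single_ne_zero (h.root_ne_zero i)) (h.reflRing_reflRing i) (h.reflRing_mul_self i)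
    (one_sub_mul_dem _ _) f

lemma isBraidFamily_dem (h : IsTypeA α φ) : IsBraidFamily fun i => dem (α i) (φ i) where
  comm i j hij := by
    ext1 f
    refine divided_comm (reflRing (α i) (φ i)) (reflRing (α j) (φ j)) _ _ (dem (α i) (φ i))
      (dem (α j) (φ j)) (one_sub_single_ne_zero (h.root_ne_zero i))
      (one_sub_single_ne_zero (h.root_ne_zero j)) (fun f => ?_) ?_ ?_
      (one_sub_mul_dem _ _) (one_sub_mul_dem _ _) f
    · suffices e : ((reflRing (α i) (φ i)).comp (reflRing (α j) (φ j))).toAddMonoidHom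
        = ((reflRing (α j) (φ j)).comp (reflRing (α i) (φ i))).toAddMonoidHom from
          DFunLike.congr_fun e f
      refine groupRing_hom_ext fun v => ?_
      change reflRing (α i) (φ i) (reflRing (α j) (φ j) (single v 1))
        = reflRing (α j) (φ j) (reflRing (α i) (φ i) (single v 1))
      simp only [reflRing_single, map_sub, map_zsmul, h.far_left i j hij, h.far_right i j hij]
      congr 1
      simp only [smul_zero, sub_zero]
      abel
    · rw [reflRing_single, map_neg, h.far_left i j hij]; simp
    · rw [reflRing_single, map_neg, h.far_right i j hij]; simp
  braid i := by
    ext1 f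
    refine divided_braid (reflRing (α i) (φ i)) (reflRing (α (i + 1)) (φ (i + 1)))
      (single (-α i) 1) (single (-α (i + 1)) 1) (dem (α i) (φ i))
      (dem (α (i + 1)) (φ (i + 1))) (one_sub_single_ne_zero (h.root_ne_zero i))
      (one_sub_single_ne_zero (h.root_ne_zero (i + 1))) ?_ (h.reflRing_reflRing i)
      (h.reflRing_reflRing (i + 1)) (fun f => ?_) (h.reflRing_mul_self i)
      (h.reflRing_mul_self (i + 1)) ?_ ?_ (one_sub_mul_dem _ _) (one_sub_mul_dem _ _) f
    · rw [AddMonoidAlgebra.single_mul_single, mul_one]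
      apply one_sub_single_ne_zero
      intro h0
      have := congrArg (φ i) h0
      simp [h.self, h.succ_right] at this
    · suffices e : ((reflRing (α i) (φ i)).comp ((reflRing (α (i + 1)) (φ (i + 1))).comp
          (reflRing (α i) (φ i)))).toAddMonoidHom
        = ((reflRing (α (i + 1)) (φ (i + 1))).comp ((reflRing (α i) (φ i)).comp
          (reflRing (α (i + 1)) (φ (i + 1))))).toAddMonoidHom from
          DFunLike.congr_fun e f
      refine groupRing_hom_ext fun v => ?_
      change reflRing (α i) (φ i) (reflRing (α (i + 1)) (φ (i + 1))
          (reflRing (α i) (φ i) (single v 1)))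
        = reflRing (α (i + 1)) (φ (i + 1)) (reflRing (α i) (φ i)
          (reflRing (α (i + 1)) (φ (i + 1)) (single v 1)))
      simp only [reflRing_single, map_sub, map_zsmul, h.self, h.succ_left, h.succ_right]
      congr 1
      module
    · rw [reflRing_single, AddMonoidAlgebra.single_mul_single, map_neg, h.succ_right, mul_one]
      congr 1
      simp; abel
    · rw [reflRing_single, AddMonoidAlgebra.single_mul_single, map_neg, h.succ_left, mul_one]
      congr 1
      simp; abel

end IsTypeA

end Relations

section Branching

variable {V : Type} [AddCommGroup V]

/-- The elements of the group ring supported on the weights `v` with `φ v = N`. -/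
noncomputable def homogeneous (φ : V →+ ℤ) (N : ℤ) : AddSubgroup (AddMonoidAlgebra ℤ V) :=
  AddSubgroup.closure {x | ∃ v, φ v = N ∧ x = single v 1}

lemma single_mul_mem_homogeneous {φ : V →+ ℤ} {N N' : ℤ} {u : V} {f : AddMonoidAlgebra ℤ V}
    (h : N' = φ u + N) (hf : f ∈ homogeneous φ N) : single u 1 * f ∈ homogeneous φ N' := by
  induction hf using AddSubgroup.closure_induction with
  | mem x hx =>
    obtain ⟨v, hv, rfl⟩ := hx
    rw [AddMonoidAlgebra.single_mul_single, mul_one]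
    exact AddSubgroup.subset_closure ⟨_, by rw [map_add, hv, h], rfl⟩
  | zero => rw [mul_zero]; exact zero_mem _
  | add x y _ _ hx hy => rw [mul_add]; exact add_mem hx hy
  | neg x _ hx => rw [mul_neg]; exact neg_mem hx

lemma dem_of_mem_homogeneous {α : V} {φ : V →+ ℤ} {N : ℕ} {f : AddMonoidAlgebra ℤ V}
    (hf : f ∈ homogeneous φ N) :
    dem α φ f = ∑ K ∈ Finset.range (N + 1), single (-(K • α)) 1 * f := by
  induction hf using AddSubgroup.closure_induction with
  | mem x hx =>
    obtain ⟨v, hv, rfl⟩ := hx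
    rw [dem_single, demSum, if_pos (by omega), hv, Int.toNat_natCast]
    refine Finset.sum_congr rfl fun k _ => ?_
    rw [AddMonoidAlgebra.single_mul_single, mul_one, sub_eq_neg_add]
  | zero => simp
  | add x y _ _ hx hy => simp only [map_add, hx, hy, mul_add, Finset.sum_add_distrib]
  | neg x _ hx => simp only [map_neg, hx, mul_neg, Finset.sum_neg_distrib]

lemma dem_single_mul {α : V} {φ : V →+ ℤ} {u : V} (hu : φ u = 0) (f : AddMonoidAlgebra ℤ V) :
    dem α φ (single u 1 * f) = single u 1 * dem α φ f := by
  let m : AddMonoidAlgebra ℤ V →+ AddMonoidAlgebra ℤ V := AddMonoidHom.mulLeft (single u 1)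
  obtain ⟨d, hd⟩ : ∃ d : AddMonoidAlgebra ℤ V →+ AddMonoidAlgebra ℤ V, ∀ x, d x = dem α φ x :=
    ⟨dem α φ, fun _ => rfl⟩
  have hm : ∀ x, m x = single u 1 * x := fun _ => rfl
  suffices h : d.comp m = m.comp d by
    rw [← hd, ← hd, ← hm, ← hm]
    exact DFunLike.congr_fun h f
  refine groupRing_hom_ext fun v => ?_
  rw [AddMonoidHom.comp_apply, AddMonoidHom.comp_apply, hm, hm, hd, hd,
    AddMonoidAlgebra.single_mul_single, mul_one, dem_single, dem_single, demSum, demSum, map_add, hu, zero_add]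
  split_ifs
  · rw [Finset.mul_sum]
    refine Finset.sum_congr rfl fun k _ => ?_
    rw [AddMonoidAlgebra.single_mul_single, mul_one, add_sub_assoc]
  · rw [mul_neg, Finset.mul_sum]
    refine congrArg _ (Finset.sum_congr rfl fun k _ => ?_)
    rw [AddMonoidAlgebra.single_mul_single, mul_one, add_assoc]

variable (α : ℕ → V) (φ : ℕ → V →+ ℤ)

/-- The composite of Demazure operators along a word. -/
noncomputable def demWord (l : List ℕ) : AddMonoid.End (AddMonoidAlgebra ℤ V) :=
  (l.map fun i => dem (α i) (φ i)).prod

@[simp] lemma demWord_nil (f : AddMonoidAlgebra ℤ V) : demWord α φ [] f = f := rfl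

@[simp] lemma demWord_cons (i : ℕ) (l : List ℕ) (f : AddMonoidAlgebra ℤ V) :
    demWord α φ (i :: l) f = dem (α i) (φ i) (demWord α φ l f) := by
  simp [demWord]

lemma demWord_append (l l' : List ℕ) (f : AddMonoidAlgebra ℤ V) :
    demWord α φ (l ++ l') f = demWord α φ l (demWord α φ l' f) := by
  simp [demWord]

/-- The additive monoid spanned by the Demazure characters of the first `n` simple roots. -/
noncomputable def demCone (n : ℕ) : AddSubmonoid (AddMonoidAlgebra ℤ V) :=
  AddSubmonoid.closure {x | ∃ (l : List ℕ) (ν : V), (∀ i ∈ l, i < n) ∧ (∀ i < n, 0 ≤ φ i ν) ∧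
    x = demWord α φ l (single ν 1)}

variable {α φ}

lemma demWord_mem_demCone {n : ℕ} {l : List ℕ} (hl : ∀ i ∈ l, i < n)
    {f : AddMonoidAlgebra ℤ V} (hf : f ∈ demCone α φ n) : demWord α φ l f ∈ demCone α φ n := by
  induction hf using AddSubmonoid.closure_induction with
  | mem x hx =>
    obtain ⟨l', ν, hl', hν, rfl⟩ := hx
    refine AddSubmonoid.subset_closure ⟨l ++ l', ν, ?_, hν, by rw [demWord_append]⟩
    intro i hi
    rcases List.mem_append.1 hi with h | h
    exacts [hl i h, hl' i h]
  | zero => rw [map_zero]; exact zero_mem _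
  | add x y _ _ hx hy => rw [map_add]; exact add_mem hx hy

lemma demWord_single_mul {l : List ℕ} {u : V} (hu : ∀ i ∈ l, φ i u = 0)
    (f : AddMonoidAlgebra ℤ V) :
    demWord α φ l (single u 1 * f) = single u 1 * demWord α φ l f := by
  induction l with
  | nil => rfl
  | cons i l ih =>
    rw [demWord_cons, demWord_cons, ih fun i hi => hu i (by simp [hi]),
      dem_single_mul (hu i (by simp))]

variable (α φ)

/-- The partial sum `λ_j + ⋯ + λ_{j+s-1}` of the coordinates `λ_i = φ_i(λ)`. -/
def branchBound (lam : V) (j : ℕ) : ℕ → ℕ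
  | 0 => 0
  | s + 1 => branchBound lam j s + (φ (j + s) lam).toNat

/-- The part of `D_{j+s-1} ⋯ D_j e^λ` on which `α_{j+s-1}` has been subtracted `K` times. -/
noncomputable def branchPart (lam : V) (j : ℕ) : ℕ → ℕ → AddMonoidAlgebra ℤ V
  | 0, K => if K = 0 then single lam 1 else 0
  | s + 1, K => ∑ k ∈ Finset.range (branchBound φ lam j s + 1),
      if K ≤ k + (φ (j + s) lam).toNat then single (-(K • α (j + s))) 1 * branchPart lam j s k
      else 0

variable {α φ} {lam : V} {j : ℕ}

lemma IsTypeA.branchPart_mem_homogeneous (h : IsTypeA α φ) (s K : ℕ) :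
    branchPart α φ lam j s K ∈ homogeneous (φ (j + s)) (φ (j + s) lam + K) ∧
      ∀ p, j + s < p → branchPart α φ lam j s K ∈ homogeneous (φ p) (φ p lam) := by
  induction s generalizing K with
  | zero =>
    rw [branchPart]
    split_ifs with hK
    · subst hK
      exact ⟨AddSubgroup.subset_closure ⟨lam, by simp, rfl⟩,
        fun p _ => AddSubgroup.subset_closure ⟨lam, rfl, rfl⟩⟩
    · exact ⟨zero_mem _, fun _ _ => zero_mem _⟩
  | succ s ih =>
    rw [branchPart]
    refine ⟨sum_mem fun k _ => ?_, fun p hp => sum_mem fun k _ => ?_⟩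
    · split_ifs
      · refine single_mul_mem_homogeneous ?_ ((ih k).2 _ (by omega))
        rw [map_neg, map_nsmul, ← add_assoc, h.succ_left]
        simp [add_comm]
      · exact zero_mem _
    · split_ifs
      · refine single_mul_mem_homogeneous ?_ ((ih k).2 p (by omega))
        rw [map_neg, map_nsmul, h.far_right _ _ (by omega)]
        simp
      · exact zero_mem _

lemma IsTypeA.demWord_descWord (h : IsTypeA α φ) (s : ℕ)
    (hlam : ∀ i < j + s, 0 ≤ φ i lam) :
    demWord α φ (descWord j s) (single lam 1)
      = ∑ k ∈ Finset.range (branchBound φ lam j s + 1), branchPart α φ lam j s k := by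
  induction s with
  | zero => simp [descWord, branchBound, branchPart]
  | succ s ih =>
    rw [descWord, demWord_cons, ih fun i hi => hlam i (by omega), map_sum]
    simp only [branchPart, branchBound]
    rw [Finset.sum_comm]
    refine Finset.sum_congr rfl fun k hk => ?_
    have hk := Finset.mem_range.1 hk
    have h0 := hlam (j + s) (by omega)
    have h1 := (h.branchPart_mem_homogeneous (lam := lam) (j := j) s k).1
    rw [show φ (j + s) lam + k = ((k + (φ (j + s) lam).toNat : ℕ) : ℤ) by omega] at h1
    rw [dem_of_mem_homogeneous h1, ← Finset.sum_filter]
    refine Finset.sum_congr ?_ fun _ _ => rfl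
    ext K
    simp only [Finset.mem_filter, Finset.mem_range]
    omega

lemma IsTypeA.dem_branchPart (h : IsTypeA α φ) (s K : ℕ)
    (hlam : 0 ≤ φ (j + s) lam) :
    dem (α (j + s)) (φ (j + s))
        (single (-(K • α (j + s + 1))) 1 * branchPart α φ lam j (s + 1) K)
      = ∑ k ∈ Finset.range (branchBound φ lam j (s + 1) + 1),
        if K ≤ k then single (-(K • α (j + s + 1))) 1 * branchPart α φ lam j (s + 1) k else 0 := by
  simp only [branchPart, branchBound, Finset.mul_sum, map_sum]
  simp only [← Finset.sum_filter]
  rw [Finset.sum_comm' (t' := Finset.range (branchBound φ lam j s + 1))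
    (s' := fun _ => (Finset.range (branchBound φ lam j s + (φ (j + s) lam).toNat + 1)).filter
      fun k => K ≤ k) (by intro x y; tauto)]
  refine Finset.sum_congr rfl fun k hk => ?_
  have hk := Finset.mem_range.1 hk
  have h1 := (h.branchPart_mem_homogeneous (lam := lam) (j := j) s k).1
  split_ifs with hK
  · have h2 : single (-(K • α (j + s + 1))) 1 * (single (-(K • α (j + s))) 1 *
        branchPart α φ lam j s k) ∈ homogeneous (φ (j + s))
          ((k + (φ (j + s) lam).toNat - K : ℕ) : ℤ) := by
      refine single_mul_mem_homogeneous ?_ (single_mul_mem_homogeneous rfl h1)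
      simp only [map_neg, map_nsmul, h.succ_right, h.self, nsmul_eq_mul]
      omega
    simp only [mul_ite, mul_zero]
    rw [dem_of_mem_homogeneous h2, ← Finset.sum_filter, Finset.filter_filter]
    refine Finset.sum_bij (fun t _ => K + t) ?_ ?_ ?_ ?_
    · intro t ht
      simp only [Finset.mem_filter, Finset.mem_range] at ht ⊢
      omega
    · intro a _ b _ hab
      omega
    · intro b hb
      simp only [Finset.mem_filter, Finset.mem_range] at hb
      refine ⟨b - K, ?_, by omega⟩
      simp only [Finset.mem_range]
      omega
    · intro t _
      rw [← mul_assoc, ← mul_assoc, ← mul_assoc]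
      congr 1
      simp only [AddMonoidAlgebra.single_mul_single, mul_one]
      congr 1
      rw [add_smul]
      abel
  · rw [mul_zero, map_zero]
    refine (Finset.sum_eq_zero fun x hx => ?_).symm
    rw [if_neg, mul_zero]
    have := (Finset.mem_filter.1 hx).2
    omega

/-- Each branching part is a sum of Demazure characters of smaller rank. -/
lemma IsTypeA.branchPart_mem_closure (h : IsTypeA α φ) (s K : ℕ)
    (hlam : ∀ i ≤ j + s, 0 ≤ φ i lam) :
    branchPart α φ lam j (s + 1) K ∈ AddSubmonoid.closure
      {x | ∃ (l : List ℕ) (ν : V), (∀ i ∈ l, i < j + s) ∧ (∀ i < j + s, 0 ≤ φ i ν) ∧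
        -(K : ℤ) ≤ φ (j + s) ν ∧ φ (j + s + 1) ν = φ (j + s + 1) lam + K ∧
        (∀ p, j + s + 1 < p → φ p ν = φ p lam) ∧ x = demWord α φ l (single ν 1)} := by
  induction s generalizing K with
  | zero =>
    rw [branchPart]
    refine sum_mem fun k _ => ?_
    simp only [branchPart]
    split_ifs with hK hk
    · refine AddSubmonoid.subset_closure ⟨[], lam - K • α (j + 0), by simp, fun i hi => ?_, ?_, ?_,
        fun p hp => ?_, ?_⟩
      · have h0 := hlam i (by omega)
        rw [map_sub, map_nsmul]
        rcases Nat.lt_or_ge (i + 1) j with hij | hij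
        · rw [h.far_left _ _ (by omega)]; simpa using h0
        · obtain rfl : j = i + 1 := by omega
          rw [add_zero, h.succ_right, nsmul_eq_mul]; omega
      · have h0 := hlam (j + 0) le_rfl
        rw [map_sub, map_nsmul, h.self, nsmul_eq_mul]; omega
      · rw [map_sub, map_nsmul, h.succ_left (j + 0), nsmul_eq_mul]; omega
      · rw [map_sub, map_nsmul, h.far_right _ _ (by omega), smul_zero, sub_zero]
      · rw [demWord_nil, AddMonoidAlgebra.single_mul_single, mul_one, sub_eq_neg_add]
    · rw [mul_zero]; exact zero_mem _
    · exact zero_mem _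
  | succ s ih =>
    have step : ∀ k, k ≤ K → K ≤ k + (φ (j + (s + 1)) lam).toNat → ∀ l₀ : List ℕ,
        (∀ i ∈ l₀, i < j + (s + 1)) →
        demWord α φ l₀ (single (-(K • α (j + (s + 1)))) 1 * branchPart α φ lam j (s + 1) k) ∈
        AddSubmonoid.closure
      {x | ∃ (l : List ℕ) (ν : V), (∀ i ∈ l, i < j + (s + 1)) ∧ (∀ i < j + (s + 1), 0 ≤ φ i ν) ∧
        -(K : ℤ) ≤ φ (j + (s + 1)) ν ∧ φ (j + (s + 1) + 1) ν = φ (j + (s + 1) + 1) lam + K ∧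
        (∀ p, j + (s + 1) + 1 < p → φ p ν = φ p lam) ∧ x = demWord α φ l (single ν 1)} := by
      intro k hkK hK l₀ hl₀
      have hk := ih k fun i hi => hlam i (by omega)
      generalize branchPart α φ lam j (s + 1) k = x at hk
      induction hk using AddSubmonoid.closure_induction with
      | zero => rw [mul_zero, map_zero]; exact zero_mem _
      | add x y _ _ hx hy => rw [mul_add, map_add]; exact add_mem hx hy
      | mem x hx =>
        obtain ⟨l, ν, hl, hν, h1, h2, h3, rfl⟩ := hx
        have h0 := hlam (j + (s + 1)) le_rfl
        refine AddSubmonoid.subset_closure ⟨l₀ ++ l, -(K • α (j + (s + 1))) + ν, ?_, ?_, ?_, ?_, ?_,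
          ?_⟩
        · intro i hi
          rcases List.mem_append.1 hi with hi | hi
          · exact hl₀ i hi
          · have := hl i hi; omega
        · intro i hi
          rw [map_add, map_neg, map_nsmul]
          rcases Nat.lt_or_ge i (j + s) with hij | hij
          · rw [h.far_left _ _ (by omega)]; simpa using hν i hij
          · obtain rfl : i = j + s := by omega
            rw [← add_assoc, h.succ_right, nsmul_eq_mul]; omega
        · rw [map_add, map_neg, map_nsmul, h.self, nsmul_eq_mul]
          rw [← add_assoc] at h0 hK ⊢
          omega
        · rw [map_add, map_neg, map_nsmul, h.succ_left, h3 _ (by omega), nsmul_eq_mul]; omega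
        · intro p hp
          rw [map_add, map_neg, map_nsmul, h.far_right _ _ (by omega), h3 _ (by omega)]
          simp
        · rw [demWord_append, ← demWord_single_mul, AddMonoidAlgebra.single_mul_single, mul_one]
          intro i hi
          have := hl i hi
          rw [map_neg, map_nsmul, h.far_left _ _ (by omega)]
          simp
    have split : branchPart α φ lam j (s + 1 + 1) K =
        (∑ k ∈ Finset.range (branchBound φ lam j (s + 1) + 1),
          if k < K ∧ K ≤ k + (φ (j + (s + 1)) lam).toNat then
            single (-(K • α (j + (s + 1)))) 1 * branchPart α φ lam j (s + 1) k else 0) +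
        dem (α (j + s)) (φ (j + s))
          (single (-(K • α (j + (s + 1)))) 1 * branchPart α φ lam j (s + 1) K) := by
      rw [← add_assoc, h.dem_branchPart s K (hlam _ (by omega)), ← Finset.sum_add_distrib,
        branchPart]
      refine Finset.sum_congr rfl fun k _ => ?_
      rw [← add_assoc]
      split_ifs <;> first | omega | simp
    rw [split]
    refine add_mem (sum_mem fun k _ => ?_) ?_
    · split_ifs with hk
      · exact step k hk.1.le hk.2 [] (by simp)
      · exact zero_mem _
    · simpa using step K le_rfl (by omega) [j + s] (by simp)

variable [UniqueSums V]

/-- Branching: Demazure characters of rank `n + 1` are sums of Demazure characters of rank `n`. -/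
lemma IsTypeA.demCone_succ_le (h : IsTypeA α φ) (n : ℕ) :
    demCone α φ (n + 1) ≤ demCone α φ n := by
  refine AddSubmonoid.closure_le.2 ?_
  rintro _ ⟨l, ν, hl, hν, rfl⟩
  obtain ⟨c, hc, e⟩ := exists_normalWord_of_idempotent h.isBraidFamily_dem h.dem_idem hl
  change demWord α φ l = demWord α φ (normalWord c (n + 1)) at e
  rw [e, normalWord, SetLike.mem_coe, demWord_append]
  refine demWord_mem_demCone (fun i hi => mem_normalWord_lt hc hi) ?_
  have hcn := hc n
  rcases Nat.lt_or_ge n (c n) with hn | hn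
  · rw [show n + 1 - c n = 0 by omega, descWord, demWord_nil]
    exact AddSubmonoid.subset_closure ⟨[], ν, by simp, fun i hi => hν i (by omega), rfl⟩
  · obtain ⟨s, hs⟩ : ∃ s, n = c n + s := ⟨n - c n, by omega⟩
    rw [show n + 1 - c n = s + 1 by omega, h.demWord_descWord (s + 1) fun i hi => hν i (by omega)]
    refine sum_mem fun k _ => ?_
    refine AddSubmonoid.closure_mono ?_
      (h.branchPart_mem_closure (lam := ν) (j := c n) s k fun i hi => hν i (by omega))
    rintro _ ⟨l, ν', hl', hν', -, -, -, rfl⟩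
    rw [← hs] at hl' hν'
    exact ⟨l, ν', hl', hν', rfl⟩

lemma IsTypeA.demCone_antitone (h : IsTypeA α φ) : Antitone (demCone α φ) :=
  antitone_nat_of_succ_le h.demCone_succ_le

end Branching

section StringProperty

variable {V : Type} [AddCommGroup V]

lemma coeff_demSum {α : V} {φ : V →+ ℤ} {ν : V} (hν : 0 ≤ φ ν) (w : V) :
    0 ≤ (demSum α φ ν).coeff w ∧
      (0 < (demSum α φ ν).coeff w ↔ ∃ k : ℕ, (k : ℤ) ≤ φ ν ∧ w = ν - k • α) := by
  classical
  have e : (demSum α φ ν).coeff w =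
      ∑ k ∈ Finset.range ((φ ν).toNat + 1), if ν - k • α = w then 1 else 0 := by
    rw [demSum, if_pos hν, AddMonoidAlgebra.coeff_sum, Finsupp.finsetSum_apply]
    refine Finset.sum_congr rfl fun k _ => ?_
    rw [AddMonoidAlgebra.coeff_single, Finsupp.single_apply]
  have h0 : ∀ k ∈ Finset.range ((φ ν).toNat + 1), (0 : ℤ) ≤ if ν - k • α = w then 1 else 0 := by
    intro k _
    split_ifs <;> simp
  rw [e, Finset.sum_pos_iff_of_nonneg h0]
  refine ⟨Finset.sum_nonneg h0, ?_⟩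
  constructor
  · rintro ⟨k, hk, h⟩
    rw [Finset.mem_range] at hk
    refine ⟨k, by omega, ?_⟩
    by_contra hne
    rw [if_neg fun h => hne h.symm] at h
    exact lt_irrefl _ h
  · rintro ⟨k, hk, rfl⟩
    exact ⟨k, Finset.mem_range.2 (by omega), by simp⟩

variable {α : ℕ → V} {φ : ℕ → V →+ ℤ} [UniqueSums V]

/-- Elements of the rank one cone have nonnegative coefficients, and their Demazure images are
strictly positive along the strings through their supports. -/
lemma IsTypeA.string_positivity (h : IsTypeA α φ) {f : AddMonoidAlgebra ℤ V}
    (hf : f ∈ demCone α φ 1) :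
    (∀ v, 0 ≤ f.coeff v) ∧ (∀ v, 0 ≤ (dem (α 0) (φ 0) f).coeff v) ∧
      ∀ (v : V) (k : ℕ), 0 < f.coeff v → (k : ℤ) ≤ φ 0 v →
        0 < (dem (α 0) (φ 0) f).coeff (v - k • α 0) := by
  classical
  have idem : ∀ x, dem (α 0) (φ 0) (dem (α 0) (φ 0) x) = dem (α 0) (φ 0) x := fun x =>
    DFunLike.congr_fun (h.dem_idem 0) x
  induction hf using AddSubmonoid.closure_induction with
  | mem x hx =>
    obtain ⟨l, ν, hl, hν, rfl⟩ := hx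
    have h0 : 0 ≤ φ 0 ν := hν 0 (by omega)
    have hl' : demWord α φ l (single ν 1) = single ν 1 ∨
        demWord α φ l (single ν 1) = demSum (α 0) (φ 0) ν := by
      clear h0
      induction l with
      | nil => exact .inl rfl
      | cons i l ih =>
        obtain rfl : i = 0 := by have := hl i (by simp); omega
        rw [demWord_cons]
        rcases ih fun i hi => hl i (by simp [hi]) with e | e
        · exact .inr (by rw [e, dem_single])
        · exact .inr (by rw [e, ← dem_single, idem])
    rcases hl' with e | e
    · rw [e, dem_single]
      refine ⟨fun v => ?_, fun v => (coeff_demSum h0 v).1, fun v k hv hk => ?_⟩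
      · rw [AddMonoidAlgebra.coeff_single, Finsupp.single_apply]
        split_ifs <;> simp
      · rw [AddMonoidAlgebra.coeff_single, Finsupp.single_apply] at hv
        obtain rfl : ν = v := by
          by_contra hne
          simp [hne] at hv
        exact (coeff_demSum h0 _).2.2 ⟨k, hk, rfl⟩
    · have e' : dem (α 0) (φ 0) (demSum (α 0) (φ 0) ν) = demSum (α 0) (φ 0) ν := by
        rw [← dem_single, idem]
      rw [e, e']
      refine ⟨fun v => (coeff_demSum h0 v).1, fun v => (coeff_demSum h0 v).1,
        fun v k hv hk => ?_⟩
      obtain ⟨a, ha, rfl⟩ := (coeff_demSum h0 _).2.1 hv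
      rw [map_sub, map_nsmul, h.self, nsmul_eq_mul] at hk
      exact (coeff_demSum h0 _).2.2 ⟨a + k, by push_cast; omega, by rw [add_smul]; abel⟩
  | zero => simp
  | add x y _ _ hx hy =>
    obtain ⟨hx1, hx2, hx3⟩ := hx
    obtain ⟨hy1, hy2, hy3⟩ := hy
    simp only [map_add, AddMonoidAlgebra.coeff_add, Finsupp.add_apply]
    refine ⟨fun v => add_nonneg (hx1 v) (hy1 v), fun v => add_nonneg (hx2 v) (hy2 v),
      fun v k hv hk => ?_⟩
    rcases (hx1 v).lt_or_eq with hv' | hv'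
    · exact add_pos_of_pos_of_nonneg (hx3 v k hv' hk) (hy2 _)
    · rw [← hv', zero_add] at hv
      exact add_pos_of_nonneg_of_pos (hx2 _) (hy3 v k hv hk)

end StringProperty

section Coordinates

/-- The root `e_i - e_{i+1}` of `ℤ^ℤ`. -/
def intRoot (i : ℤ) : ℤ → ℤ := Pi.single i 1 - Pi.single (i + 1) 1

/-- The coroot of `intRoot i`. -/
def intCoroot (i : ℤ) : (ℤ → ℤ) →+ ℤ :=
  Pi.evalAddMonoidHom (fun _ => ℤ) i - Pi.evalAddMonoidHom (fun _ => ℤ) (i + 1)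

lemma intRoot_apply (i a : ℤ) :
    intRoot i a = (if a = i then 1 else 0) - if a = i + 1 then 1 else 0 := by
  simp [intRoot, Pi.single_apply]

lemma intCoroot_apply (i : ℤ) (v : ℤ → ℤ) : intCoroot i v = v i - v (i + 1) := rfl

lemma isTypeA_int : IsTypeA (fun m : ℕ => intRoot m) (fun m : ℕ => intCoroot m) := by
  constructor <;> intros <;> simp only [intCoroot_apply, intRoot_apply] <;> split_ifs <;> omega

lemma isTypeA_int_sub (i : ℤ) :
    IsTypeA (fun m : ℕ => intRoot (i - m)) (fun m : ℕ => intCoroot (i - m)) := by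
  constructor <;> intros <;> simp only [intCoroot_apply, intRoot_apply] <;> split_ifs <;> omega

/-- The composite of Demazure operators along a word, in coordinates. -/
noncomputable abbrev intDemWord (l : List ℕ) : AddMonoid.End (AddMonoidAlgebra ℤ (ℤ → ℤ)) :=
  demWord (fun m : ℕ => intRoot m) (fun m : ℕ => intCoroot m) l

lemma intDemWord_mem_demCone {r i : ℕ} (hi : i < r) {l : List ℕ} (hl : ∀ x ∈ l, x < r)
    {lam : ℤ → ℤ} (hlam : ∀ x < r, lam (x + 1) ≤ lam x) :
    intDemWord l (single lam 1) ∈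
      demCone (fun m : ℕ => intRoot (i - m)) (fun m : ℕ => intCoroot (i - m)) 1 := by
  have h1 : intDemWord l (single lam 1) ∈
      demCone (fun m : ℕ => intRoot m) (fun m : ℕ => intCoroot m) (i + 1) := by
    refine isTypeA_int.demCone_antitone (show i + 1 ≤ r by omega)
      (AddSubmonoid.subset_closure ⟨l, lam, hl, fun x hx => ?_, rfl⟩)
    rw [intCoroot_apply]
    exact sub_nonneg.2 (hlam x hx)
  refine (isTypeA_int_sub i).demCone_antitone (show 1 ≤ i + 1 by omega) ?_
  refine AddSubmonoid.closure_mono ?_ h1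
  rintro _ ⟨l, ν, hl, hν, rfl⟩
  refine ⟨l.map fun x => i - x, ν, ?_, fun x hx => ?_, ?_⟩
  · intro y hy
    obtain ⟨x, _, rfl⟩ := List.mem_map.1 hy
    omega
  · have := hν (i - x) (by omega)
    dsimp only at this ⊢
    rwa [Nat.cast_sub (by omega)] at this
  · rw [demWord, demWord, List.map_map]
    congr 2
    refine List.map_congr_left fun x hx => ?_
    have := hl x hx
    simp only [Function.comp_apply]
    rw [Nat.cast_sub (by omega), sub_sub_cancel]

lemma coeff_intDemWord_nonneg {r : ℕ} {l : List ℕ} (hl : ∀ x ∈ l, x < r)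
    {lam : ℤ → ℤ} (hlam : ∀ x < r, lam (x + 1) ≤ lam x) (v : ℤ → ℤ) :
    0 ≤ (intDemWord l (single lam 1)).coeff v := by
  classical
  cases l with
  | nil =>
    rw [demWord_nil, AddMonoidAlgebra.coeff_single, Finsupp.single_apply]
    split_ifs <;> simp
  | cons i l =>
    exact ((isTypeA_int_sub i).string_positivity
      (intDemWord_mem_demCone (hl i (by simp)) hl hlam)).1 v

lemma coeff_intDemWord_cons_pos {r i : ℕ} {l : List ℕ} (hl : ∀ x ∈ i :: l, x < r)
    {lam : ℤ → ℤ} (hlam : ∀ x < r, lam (x + 1) ≤ lam x) {v : ℤ → ℤ} {k : ℕ}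
    (hv : 0 < (intDemWord l (single lam 1)).coeff v) (hk : (k : ℤ) ≤ v i - v (i + 1)) :
    0 < (intDemWord (i :: l) (single lam 1)).coeff (v - k • intRoot i) := by
  have := ((isTypeA_int_sub i).string_positivity
    (intDemWord_mem_demCone (hl i (by simp)) (fun x hx => hl x (by simp [hx])) hlam)).2.2 v k hv
    (by simpa [intCoroot_apply] using hk)
  rw [demWord_cons]
  simpa using this

end Coordinates

section RankFunction

/-- Replace `i + 1` by `i` in a finite set containing `i + 1` but not `i`. -/
def shiftDown (i : ℤ) (A : Finset ℤ) : Finset ℤ :=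
  if i ∉ A ∧ i + 1 ∈ A then insert i (A.erase (i + 1)) else A

lemma mem_shiftDown {i x : ℤ} {A : Finset ℤ} :
    x ∈ shiftDown i A ↔ (x = i ∧ (i ∈ A ∨ i + 1 ∈ A)) ∨ (x = i + 1 ∧ i ∈ A ∧ i + 1 ∈ A) ∨
      (x ≠ i ∧ x ≠ i + 1 ∧ x ∈ A) := by
  unfold shiftDown
  split_ifs with h
  · simp only [Finset.mem_insert, Finset.mem_erase]
    by_cases h1 : x = i
    · subst h1; simp [h.2]
    · by_cases h2 : x = i + 1
      · subst h2; simp [h.1]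
      · simp [h1, h2]
  · by_cases h1 : x = i
    · subst h1
      simp
      tauto
    · by_cases h2 : x = i + 1
      · subst h2
        simp
        tauto
      · simp [h1, h2]

lemma shiftDown_of_mem_left {i : ℤ} {A : Finset ℤ} (h : i ∈ A) : shiftDown i A = A := by
  simp [shiftDown, h]

lemma shiftDown_of_notMem_right {i : ℤ} {A : Finset ℤ} (h : i + 1 ∉ A) : shiftDown i A = A := by
  simp [shiftDown, h]

lemma shiftDown_shiftDown (i : ℤ) (A : Finset ℤ) :
    shiftDown i (shiftDown i A) = shiftDown i A := by
  by_cases h : i ∈ shiftDown i A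
  · exact shiftDown_of_mem_left h
  · apply shiftDown_of_notMem_right
    simp only [mem_shiftDown] at h ⊢
    simp at h ⊢
    tauto

lemma shiftDown_comm {i j : ℤ} (h : i + 2 ≤ j) (A : Finset ℤ) :
    shiftDown i (shiftDown j A) = shiftDown j (shiftDown i A) := by
  ext x
  simp only [mem_shiftDown]
  by_cases h1 : x = i
  · grind
  by_cases h2 : x = i + 1
  · grind
  by_cases h3 : x = j
  · grind
  by_cases h4 : x = j + 1
  · grind
  simp [h1, h2, h3, h4]

lemma shiftDown_braid (i : ℤ) (A : Finset ℤ) :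
    shiftDown i (shiftDown (i + 1) (shiftDown i A))
      = shiftDown (i + 1) (shiftDown i (shiftDown (i + 1) A)) := by
  ext x
  simp only [mem_shiftDown]
  grind

/-- The maximum of the sums over `A` of the weights `u λ`, where `u` runs over the subwords
of a word. -/
def rankFun (lam : ℤ → ℤ) : List ℕ → Finset ℤ → ℤ
  | [], A => ∑ a ∈ A, lam a
  | i :: l, A => rankFun lam l (shiftDown i A)

lemma rankFun_eq_of_braidEq {l l' : List ℕ} (h : BraidEq l l') (lam : ℤ → ℤ) :
    rankFun lam l = rankFun lam l' := by
  let T : ℕ → Function.End (Finset ℤ → ℤ) := fun i F A => F (shiftDown i A)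
  have hT : IsBraidFamily T := by
    refine ⟨fun i j hij => ?_, fun i => ?_⟩
    · funext F A
      exact congrArg F (shiftDown_comm (by exact_mod_cast hij) A).symm
    · funext F A
      have := congrArg F (shiftDown_braid i A)
      change F (shiftDown i (shiftDown ((i + 1 : ℕ) : ℤ) (shiftDown i A))) =
        F (shiftDown ((i + 1 : ℕ) : ℤ) (shiftDown i (shiftDown ((i + 1 : ℕ) : ℤ) A)))
      simpa only [Nat.cast_succ] using this
  have key : ∀ l : List ℕ, rankFun lam l = (l.map T).prod fun A => ∑ a ∈ A, lam a := by
    intro l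
    induction l with
    | nil => rfl
    | cons i l ih =>
      rw [List.map_cons, List.prod_cons]
      change _ = T i ((l.map T).prod fun A => ∑ a ∈ A, lam a)
      rw [← ih]
      rfl
  rw [key, key, h _ T hT]

variable {r : ℕ} {lam : ℤ → ℤ}

lemma rankFun_le_shiftDown (hlam : ∀ x < r, lam (x + 1) ≤ lam x) {l : List ℕ}
    (hl : ∀ x ∈ l, x < r) {j : ℕ} (hj : j < r) (A : Finset ℤ) :
    rankFun lam l A ≤ rankFun lam l (shiftDown j A) := by
  induction l generalizing j A with
  | nil =>
    simp only [rankFun, shiftDown]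
    split_ifs with h
    · rw [Finset.sum_insert (by simp [h.1]), ← Finset.add_sum_erase A lam h.2]
      have := hlam j hj
      omega
    · rfl
  | cons i l ih =>
    have ih' := fun {j : ℕ} => @ih (fun x hx => hl x (by simp [hx])) j
    have hi := hl i (by simp)
    simp only [rankFun]
    by_cases h1 : i = j
    · rw [h1, shiftDown_shiftDown]
    · by_cases h2 : i + 2 ≤ j
      · rw [shiftDown_comm (by exact_mod_cast h2)]
        exact ih' hj _
      · by_cases h3 : j + 2 ≤ i
        · rw [← shiftDown_comm (by exact_mod_cast h3)]
          exact ih' hj _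
        · by_cases h4 : (j : ℤ) ∉ A ∧ (j : ℤ) + 1 ∈ A
          · have : shiftDown i A = A := by
              rcases (by omega : i = j + 1 ∨ j = i + 1) with rfl | rfl
              · exact shiftDown_of_mem_left (by exact_mod_cast h4.2)
              · exact shiftDown_of_notMem_right (by exact_mod_cast h4.1)
            rw [this]
            exact (ih' hj A).trans (ih' hi _)
          · rw [show shiftDown j A = A from if_neg h4]

lemma rankFun_union_add_inter_le (hlam : ∀ x < r, lam (x + 1) ≤ lam x) {l : List ℕ}
    (hl : ∀ x ∈ l, x < r) (A B : Finset ℤ) :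
    rankFun lam l (A ∪ B) + rankFun lam l (A ∩ B) ≤ rankFun lam l A + rankFun lam l B := by
  induction l generalizing A B with
  | nil => exact (Finset.sum_union_inter).le
  | cons i l ih =>
    have hl' : ∀ x ∈ l, x < r := fun x hx => hl x (by simp [hx])
    have hi := hl i (by simp)
    simp only [rankFun]
    have special : ∀ A B : Finset ℤ, (i : ℤ) ∈ A → (i : ℤ) + 1 ∉ A → (i : ℤ) ∉ B →
        rankFun lam l (shiftDown i (A ∪ B)) + rankFun lam l (shiftDown i (A ∩ B)) ≤
          rankFun lam l (shiftDown i A) + rankFun lam l (shiftDown i B) := by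
      intro A B h1 h2 h3
      rw [shiftDown_of_mem_left h1, shiftDown_of_mem_left (by simp [h1]),
        shiftDown_of_notMem_right (A := A ∩ B) (by simp [h2])]
      exact (ih hl' A B).trans (by simpa using rankFun_le_shiftDown hlam hl' hi B)
    by_cases h1 : (i : ℤ) ∈ A ∧ (i : ℤ) + 1 ∉ A ∧ (i : ℤ) ∉ B
    · exact special A B h1.1 h1.2.1 h1.2.2
    by_cases h2 : (i : ℤ) ∈ B ∧ (i : ℤ) + 1 ∉ B ∧ (i : ℤ) ∉ A
    · rw [Finset.union_comm, Finset.inter_comm, add_comm (rankFun lam l (shiftDown i A))]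
      exact special B A h2.1 h2.2.1 h2.2.2
    have e1 : shiftDown i (A ∪ B) = shiftDown i A ∪ shiftDown i B := by
      ext x
      simp only [mem_shiftDown, Finset.mem_union]
      grind
    have e2 : shiftDown i (A ∩ B) = shiftDown i A ∩ shiftDown i B := by
      ext x
      simp only [mem_shiftDown, Finset.mem_inter]
      grind
    rw [e1, e2]
    exact ih hl' _ _

/-- The action of a word in the adjacent transpositions on `ℤ^ℤ`. -/
def swapAct (lam : ℤ → ℤ) : List ℕ → ℤ → ℤ
  | [] => lam
  | i :: l => swapAct lam l ∘ Equiv.swap (i : ℤ) (i + 1)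

lemma swapAct_natCast (v : ℤ → ℤ) (l : List ℕ) (a : ℕ) :
    swapAct v l a = v ((wordPerm l)⁻¹ a : ℕ) := by
  induction l generalizing a with
  | nil => rfl
  | cons i l ih =>
    rw [swapAct, Function.comp_apply, wordPerm_cons, mul_inv_rev, Equiv.Perm.mul_apply, ← ih,
      adjSwap, Equiv.swap_inv, Equiv.swap_apply_def, Equiv.swap_apply_def]
    norm_cast

lemma swapAct_of_notMem_Icc (v : ℤ → ℤ) {l : List ℕ} (hl : ∀ x ∈ l, x < r) {a : ℤ}
    (ha : a ∉ Finset.Icc (0 : ℤ) r) : swapAct v l a = v a := by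
  induction l with
  | nil => rfl
  | cons i l ih =>
    have := hl i (by simp)
    rw [Finset.mem_Icc] at ha
    rw [swapAct, Function.comp_apply, Equiv.swap_apply_of_ne_of_ne (by omega) (by omega),
      ih fun x hx => hl x (by simp [hx])]

lemma swapAct_eq_of_wordPerm_eq {l l' : List ℕ} (h : wordPerm l = wordPerm l') (v : ℤ → ℤ) :
    swapAct v l = swapAct v l' := by
  funext a
  by_cases ha : 0 ≤ a
  · lift a to ℕ using ha
    rw [swapAct_natCast, swapAct_natCast, h]
  · have key : ∀ l, swapAct v l a = v a := by
      intro l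
      obtain ⟨N, hN⟩ : ∃ N, ∀ x ∈ l, x < N :=
        ⟨l.sum + 1, fun x hx => Nat.lt_succ_of_le (List.le_sum_of_mem hx)⟩
      exact swapAct_of_notMem_Icc v hN (by rw [Finset.mem_Icc]; omega)
    rw [key, key]

lemma sum_swapAct_le_rankFun (hlam : ∀ x < r, lam (x + 1) ≤ lam x) {l l' : List ℕ}
    (h : l'.Sublist l) (hl : ∀ x ∈ l, x < r) (A : Finset ℤ) :
    ∑ a ∈ A, swapAct lam l' a ≤ rankFun lam l A := by
  induction h generalizing A with
  | slnil => rfl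
  | cons i _ ih =>
    exact (ih (fun x hx => hl x (by simp [hx])) A).trans
      (rankFun_le_shiftDown hlam (fun x hx => hl x (by simp [hx])) (hl i (by simp)) A)
  | @cons_cons l₁ l₂ i _ ih =>
    have hl' : ∀ x ∈ l₂, x < r := fun x hx => hl x (by simp [hx])
    have h1 := ih hl' (A.map (Equiv.swap (i : ℤ) (i + 1)).toEmbedding)
    rw [Finset.sum_map] at h1
    refine (h1.trans (rankFun_le_shiftDown hlam hl' (hl i (by simp)) _)).trans_eq ?_
    simp only [rankFun]
    congr 1
    ext x
    simp only [mem_shiftDown, Finset.mem_map_equiv, Equiv.symm_swap, Equiv.swap_apply_left,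
      Equiv.swap_apply_right]
    by_cases h1 : x = i
    · simp [h1, or_comm]
    · by_cases h2 : x = i + 1
      · simp [h2, and_comm]
      · simp [h1, h2, Equiv.swap_apply_of_ne_of_ne h1 h2]

lemma sum_add_smul_intRoot (mu : ℤ → ℤ) (t i : ℤ) (A : Finset ℤ) :
    ∑ a ∈ A, (mu + t • intRoot i) a =
      ∑ a ∈ A, mu a + t * ((if i ∈ A then 1 else 0) - if i + 1 ∈ A then 1 else 0) := by
  simp [intRoot_apply, Finset.sum_add_distrib, ← Finset.mul_sum]

/-- Saturation in coordinates. -/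
lemma coeff_intDemWord_pos (hlam : ∀ x < r, lam (x + 1) ≤ lam x) {l : List ℕ}
    (hl : ∀ x ∈ l, x < r) {mu : ℤ → ℤ} (hout : ∀ a ∉ Finset.Icc (0 : ℤ) r, mu a = lam a)
    (hsum : ∑ a ∈ Finset.Icc (0 : ℤ) r, mu a = ∑ a ∈ Finset.Icc (0 : ℤ) r, lam a)
    (hmu : ∀ A : Finset ℤ, ∑ a ∈ A, mu a ≤ rankFun lam l A) :
    0 < (intDemWord l (single lam 1)).coeff mu := by
  induction l generalizing mu with
  | nil =>
    have h1 : ∀ a, mu a ≤ lam a := fun a => by simpa [rankFun] using hmu {a}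
    have h2 := (Finset.sum_eq_sum_iff_of_le fun a _ => h1 a).1 hsum
    have : mu = lam := by
      funext a
      by_cases ha : a ∈ Finset.Icc (0 : ℤ) r
      · exact h2 a ha
      · exact hout a ha
    rw [this, demWord_nil, AddMonoidAlgebra.coeff_single]
    simp
  | cons i l ih =>
    have hl' : ∀ x ∈ l, x < r := fun x hx => hl x (by simp [hx])
    have hi := hl i (by simp)
    have hA : ∀ A : Finset ℤ, ((i : ℤ) ∈ A ∨ (i : ℤ) + 1 ∉ A) →
        ∑ a ∈ A, mu a ≤ rankFun lam l A := by
      intro A h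
      have := hmu A
      rw [rankFun] at this
      rcases h with h | h
      · rwa [shiftDown_of_mem_left h] at this
      · rwa [shiftDown_of_notMem_right h] at this
    obtain ⟨A, ⟨hA1, hA2⟩, hmin⟩ : ∃ A : Finset ℤ, ((i : ℤ) ∈ A ∧ (i : ℤ) + 1 ∉ A) ∧
        ∀ B : Finset ℤ, (i : ℤ) ∈ B → (i : ℤ) + 1 ∉ B →
          rankFun lam l A - ∑ a ∈ A, mu a ≤ rankFun lam l B - ∑ a ∈ B, mu a := by
      let S : Set (Finset ℤ) := {A | (i : ℤ) ∈ A ∧ (i : ℤ) + 1 ∉ A}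
      have hS : S.Nonempty := ⟨{(i : ℤ)}, by simp [S]⟩
      let g : Finset ℤ → ℕ := fun A => (rankFun lam l A - ∑ a ∈ A, mu a).toNat
      refine ⟨Function.argminOn g S hS, Function.argminOn_mem g S hS, fun B hB1 hB2 => ?_⟩
      have h1 : g (Function.argminOn g S hS) ≤ g B := Function.argminOn_le g S ⟨hB1, hB2⟩
      have h2 := hA B (.inl hB1)
      have h3 := hA (Function.argminOn g S hS) (.inl (Function.argminOn_mem g S hS).1)
      simp only [g] at h1 h3 ⊢
      omega
    obtain ⟨t, ht⟩ : ∃ t : ℕ, (t : ℤ) = rankFun lam l A - ∑ a ∈ A, mu a :=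
      ⟨(rankFun lam l A - ∑ a ∈ A, mu a).toNat, by have := hA A (.inl hA1); omega⟩
    have hpos := ih hl' (mu := mu + (t : ℤ) • intRoot i) ?_ ?_ ?_
    · have := coeff_intDemWord_cons_pos hl hlam (k := t) hpos ?_
      · rwa [natCast_zsmul, add_sub_cancel_right] at this
      · have h1 := hmu (insert ((i : ℤ) + 1) (A.erase i))
        rw [rankFun, Finset.sum_insert (by simp [hA2])] at h1
        have e : shiftDown i (insert ((i : ℤ) + 1) (A.erase i)) = A := by
          ext x
          simp only [mem_shiftDown, Finset.mem_insert, Finset.mem_erase]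
          grind
        rw [e] at h1
        have h2 := Finset.add_sum_erase A mu hA1
        simp [intRoot_apply]
        omega
    · intro a ha
      rw [← hout a ha]
      simp only [Finset.mem_Icc] at ha
      simp [intRoot_apply, show a ≠ i by omega, show a ≠ i + 1 by omega]
    · rw [sum_add_smul_intRoot, ← hsum, if_pos (by simp; omega), if_pos (by simp; omega)]
      simp
    · intro B
      rw [sum_add_smul_intRoot]
      by_cases hB1 : (i : ℤ) ∈ B
      · by_cases hB2 : (i : ℤ) + 1 ∈ B
        · simpa [hB1, hB2] using hA B (.inl hB1)
        · have := hmin B hB1 hB2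
          simp only [hB1, hB2, if_true, if_false]
          omega
      · by_cases hB2 : (i : ℤ) + 1 ∈ B
        · have h1 := rankFun_union_add_inter_le hlam hl' A B
          have h2 := hA (A ∪ B) (.inl (by simp [hA1]))
          have h3 := hA (A ∩ B) (.inr (by simp [hA2]))
          have h4 := Finset.sum_union_inter (s₁ := A) (s₂ := B) (f := mu)
          simp only [hB1, hB2, if_true, if_false]
          omega
        · simpa [hB1, hB2] using hA B (.inr hB2)

end RankFunction

namespace RootData

variable {R : RootData}

lemma S_apply {i : Fin R.r} (h : R.coroot (R.α i) (R.α i) = 2) (x : R.V) :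
    R.S i x = x - R.coroot (R.α i) x • R.α i := by
  have h' : (R.reflMap (R.α i)).comp (R.reflMap (R.α i)) = LinearMap.id := by
    refine LinearMap.ext fun y => ?_
    simp only [reflMap, LinearMap.comp_apply, LinearMap.sub_apply, LinearMap.id_apply,
      LinearMap.smulRight_apply, map_sub, map_smul, h]
    module
  rw [S, s, dif_pos h']
  rfl

lemma wordProd_cons_apply (i : Fin R.r) (l : List (Fin R.r)) (x : R.V) :
    R.wordProd (i :: l) x = R.S i (R.wordProd l x) := by
  simp [wordProd]

lemma Reduced.length_le {l l' : List (Fin R.r)} (hl : R.Reduced l)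
    (h : R.wordProd l' = R.wordProd l) : l.length ≤ l'.length := by
  rw [← hl]
  exact Nat.sInf_le ⟨l', rfl, h⟩

lemma le_of_mem_demPolytope {lam mu : R.V} {w : R.Aut} (g : Module.Dual ℚ R.V) {B : ℚ}
    (h : ∀ u, R.BruhatLE u w → g (u lam) ≤ B) (hmu : mu ∈ R.demPolytope lam w) : g mu ≤ B := by
  refine convexHull_min (t := {x | g x ≤ B}) ?_ (convex_halfSpace_le g.isLinear B) hmu
  rintro _ ⟨u, -, hu, rfl⟩
  exact h u hu

/-- An equivariant affine map from `ℤ^ℤ` to the space of a root system of type `A`. -/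
structure IsIntegralChart (R : RootData) (ι : (ℤ → ℤ) → R.V) : Prop where
  add_smul_root : ∀ (i : Fin R.r) (v : ℤ → ℤ) (c : ℤ),
    ι (v + c • intRoot (i : ℕ)) = ι v + (c : ℚ) • R.α i
  coroot_apply : ∀ (i : Fin R.r) (v : ℤ → ℤ), R.coroot (R.α i) (ι v) = intCoroot (i : ℕ) v
  apply_eq : ∀ {v w : ℤ → ℤ}, ι v = ι w → ∀ a ≤ R.r, v a = w a
  aut_ext : ∀ {f g : R.Aut}, (∀ v, f (ι v) = g (ι v)) → f = g

namespace IsIntegralChart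

variable {ι : (ℤ → ℤ) → R.V}

lemma coroot_self (hι : R.IsIntegralChart ι) (i : Fin R.r) : R.coroot (R.α i) (R.α i) = 2 := by
  have h1 := hι.add_smul_root i 0 1
  have h2 := congrArg (R.coroot (R.α i)) h1
  rw [map_add, hι.coroot_apply, hι.coroot_apply, map_smul] at h2
  simpa [intCoroot_apply, intRoot_apply] using h2.symm

lemma S_apply (hι : R.IsIntegralChart ι) (i : Fin R.r) (v : ℤ → ℤ) :
    R.S i (ι v) = ι (v ∘ Equiv.swap ((i : ℕ) : ℤ) ((i : ℕ) + 1)) := by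
  have e : v ∘ Equiv.swap ((i : ℕ) : ℤ) ((i : ℕ) + 1) =
      v + (-intCoroot (i : ℕ) v) • intRoot (i : ℕ) := by
    funext a
    rw [Function.comp_apply, Equiv.swap_apply_def]
    simp only [Pi.add_apply, Pi.smul_apply, intRoot_apply, intCoroot_apply]
    split_ifs <;> simp_all
  rw [RootData.S_apply (hι.coroot_self i), hι.coroot_apply, e, hι.add_smul_root, Int.cast_neg,
    neg_smul, sub_eq_add_neg]

lemma wordProd_apply (hι : R.IsIntegralChart ι) (l : List (Fin R.r)) (v : ℤ → ℤ) :
    R.wordProd l (ι v) = ι (swapAct v (l.map Fin.val)) := by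
  induction l with
  | nil => rfl
  | cons i l ih => rw [wordProd_cons_apply, ih, hι.S_apply, List.map_cons, swapAct]

lemma wordProd_eq_of_wordPerm_eq (hι : R.IsIntegralChart ι) {l l' : List (Fin R.r)}
    (h : wordPerm (l.map Fin.val) = wordPerm (l'.map Fin.val)) :
    R.wordProd l = R.wordProd l' :=
  hι.aut_ext fun v => by rw [hι.wordProd_apply, hι.wordProd_apply, swapAct_eq_of_wordPerm_eq h]

lemma wordPerm_eq_of_wordProd_eq (hι : R.IsIntegralChart ι) {l l' : List (Fin R.r)}
    (h : R.wordProd l = R.wordProd l') :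
    wordPerm (l.map Fin.val) = wordPerm (l'.map Fin.val) := by
  have hlt : ∀ l : List (Fin R.r), ∀ x ∈ l.map Fin.val, x < R.r := by simp
  rw [← inv_inj]
  ext a
  by_cases ha : R.r < a
  · rw [Equiv.Perm.inv_eq_iff_eq.2 (wordPerm_apply_of_lt (hlt l) ha).symm,
      Equiv.Perm.inv_eq_iff_eq.2 (wordPerm_apply_of_lt (hlt l') ha).symm]
  · have h1 := hι.wordProd_apply l id
    rw [h, hι.wordProd_apply] at h1
    have h2 := hι.apply_eq h1 a (by omega)
    rw [swapAct_natCast, swapAct_natCast] at h2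
    simpa using h2.symm

lemma isShortest (hι : R.IsIntegralChart ι) {l : List (Fin R.r)} (hl : R.Reduced l) :
    IsShortest R.r (l.map Fin.val) := by
  intro l' hl' e
  obtain ⟨l'', rfl⟩ : ∃ l'' : List (Fin R.r), l''.map Fin.val = l' :=
    ⟨l'.attach.map fun x => ⟨x.1, hl' x.1 x.2⟩, by simp [Function.comp_def]⟩
  rw [List.length_map, List.length_map]
  exact hl.length_le (hι.wordProd_eq_of_wordPerm_eq e)

lemma sum_le_rankFun_of_bruhatLE (hι : R.IsIntegralChart ι) {l : List (Fin R.r)}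
    (hl : R.Reduced l) {u : R.Aut} (hu : R.BruhatLE u (R.wordProd l)) {v : ℤ → ℤ}
    (hv : ∀ x < R.r, v (x + 1) ≤ v x) :
    ∃ l', (∀ x ∈ l', x < R.r) ∧ u (ι v) = ι (swapAct v l') ∧
      ∀ A : Finset ℤ, ∑ a ∈ A, swapAct v l' a ≤ rankFun v (l.map Fin.val) A := by
  obtain ⟨l₂, hl₂, e, l', hsub, rfl⟩ := hu
  refine ⟨l'.map Fin.val, by simp, hι.wordProd_apply l' v, fun A => ?_⟩
  rw [rankFun_eq_of_braidEq ((hι.isShortest hl).braidEq (by simp) (by simp) (hι.isShortest hl₂)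
    (hι.wordPerm_eq_of_wordProd_eq e.symm))]
  exact sum_swapAct_le_rankFun hv (hsub.map _) (by simp) A

lemma mapDomain_demSum (hι : R.IsIntegralChart ι) (i : Fin R.r) (v : ℤ → ℤ) :
    (demSum (intRoot (i : ℕ)) (intCoroot (i : ℕ)) v).coeff.mapDomain ι =
      R.demOnBasis i (ι v) := by
  have hc : ⌊R.coroot (R.α i) (ι v)⌋ = intCoroot (i : ℕ) v := by
    rw [hι.coroot_apply, Int.floor_intCast]
  rw [demOnBasis, demSum, hc]
  split_ifs with h1 h2
  · rw [AddMonoidAlgebra.coeff_sum, Finsupp.mapDomain_finsetSum]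
    refine Finset.sum_congr rfl fun k _ => ?_
    rw [AddMonoidAlgebra.coeff_single, Finsupp.mapDomain_single, sub_eq_add_neg, ← natCast_zsmul,
      ← neg_smul, hι.add_smul_root, Int.cast_neg, neg_smul, ← sub_eq_add_neg, Int.cast_natCast]
  · simp [h2]
  · rw [AddMonoidAlgebra.coeff_neg, AddMonoidAlgebra.coeff_sum]
    refine (map_neg (Finsupp.mapDomain.addMonoidHom (M := ℤ) ι) _).trans ?_
    rw [Finsupp.mapDomain.addMonoidHom_apply, Finsupp.mapDomain_finsetSum]
    refine congrArg _ (Finset.sum_congr rfl fun k _ => ?_)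
    rw [AddMonoidAlgebra.coeff_single, Finsupp.mapDomain_single, ← natCast_zsmul,
      hι.add_smul_root]
    norm_cast

lemma mapDomain_dem (hι : R.IsIntegralChart ι) (i : Fin R.r)
    (f : AddMonoidAlgebra ℤ (ℤ → ℤ)) :
    (dem (intRoot (i : ℕ)) (intCoroot (i : ℕ)) f).coeff.mapDomain ι =
      R.demOp i (f.coeff.mapDomain ι) := by
  let g : AddMonoidAlgebra ℤ (ℤ → ℤ) →+ (R.V →₀ ℤ) :=
    (Finsupp.mapDomain.addMonoidHom ι).comp AddMonoidAlgebra.coeffAddEquiv.toAddMonoidHom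
  have h : g.comp (dem (intRoot (i : ℕ)) (intCoroot (i : ℕ))) =
      (R.demOp i).toAddMonoidHom.comp g := by
    refine groupRing_hom_ext fun v => ?_
    change (dem _ _ (single v 1)).coeff.mapDomain ι =
      R.demOp i ((single v 1 : AddMonoidAlgebra ℤ (ℤ → ℤ)).coeff.mapDomain ι)
    rw [dem_single, hι.mapDomain_demSum, AddMonoidAlgebra.coeff_single, Finsupp.mapDomain_single]
    simp [demOp]
  exact DFunLike.congr_fun h f

lemma demChar_eq (hι : R.IsIntegralChart ι) (l : List (Fin R.r)) (v : ℤ → ℤ) :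
    R.demChar l (ι v) = (intDemWord (l.map Fin.val) (single v 1)).coeff.mapDomain ι := by
  induction l with
  | nil =>
    rw [List.map_nil, demWord_nil, AddMonoidAlgebra.coeff_single, Finsupp.mapDomain_single]
    rfl
  | cons i l ih =>
    rw [List.map_cons, demWord_cons, hι.mapDomain_dem, ← ih]
    rfl

lemma demChar_pos (hι : R.IsIntegralChart ι) {l : List (Fin R.r)} {v w : ℤ → ℤ}
    (hv : ∀ x < R.r, v (x + 1) ≤ v x)
    (hw : 0 < (intDemWord (l.map Fin.val) (single v 1)).coeff w) :
    0 < R.demChar l (ι v) (ι w) := by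
  rw [hι.demChar_eq, Finsupp.mapDomain, Finsupp.sum_apply, Finsupp.sum]
  refine Finset.sum_pos' (fun u _ => ?_) ⟨w, by simpa using hw.ne', ?_⟩
  · rw [Finsupp.single_apply]
    split_ifs
    · exact coeff_intDemWord_nonneg (by simp) hv u
    · rfl
  · rwa [Finsupp.single_eq_same]

end IsIntegralChart

end RootData

section TypeA

variable {r : ℕ}

lemma stdCoroot_single_sub_single {n : ℕ} {a b : Fin n} (h : a ≠ b) (x : Fin n → ℚ) :
    stdCoroot (Pi.single a 1 - Pi.single b 1) x = x a - x b := by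
  have key : ∀ y : Fin n → ℚ, dotL (Pi.single a 1 - Pi.single b 1) y = y a - y b := by
    intro y
    simp [dotL, sub_mul, Finset.sum_sub_distrib, Pi.single_apply]
  rw [stdCoroot, LinearMap.smul_apply, key, key]
  simp [h, h.symm]
  norm_num

/-- The point of `ℚ^{r+1}` with coordinates `t + v a`. -/
def shiftedWeight (r : ℕ) (t : ℚ) (v : ℤ → ℤ) : Fin (r + 1) → ℚ := fun a => t + v (a : ℕ)

lemma shiftedWeight_add_smul (i : Fin r) (t : ℚ) (v : ℤ → ℤ) (c : ℤ) :
    shiftedWeight r t (v + c • intRoot (i : ℕ)) =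
      shiftedWeight r t v + (c : ℚ) • (Pi.single i.castSucc 1 - Pi.single i.succ 1) := by
  funext a
  simp only [shiftedWeight, Pi.add_apply, Pi.sub_apply, Pi.smul_apply, intRoot_apply,
    Pi.single_apply, Fin.ext_iff, Fin.val_castSucc, Fin.val_succ]
  norm_cast
  push_cast
  split_ifs <;> simp [add_assoc]

lemma isIntegralChart_shiftedWeight (r : ℕ) (t : ℚ) :
    (typeA r).IsIntegralChart (shiftedWeight r t) where
  add_smul_root i v c := shiftedWeight_add_smul (r := r) i t v c
  coroot_apply i v := by
    refine (stdCoroot_single_sub_single (Fin.castSucc_lt_succ (i := i)).ne _).trans ?_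
    simp [shiftedWeight, intCoroot_apply]
  apply_eq {v w} h a ha := by
    have := congrFun h (⟨a, Nat.lt_succ_of_le ha⟩ : Fin (r + 1))
    simpa [shiftedWeight] using this
  aut_ext {f g} h := by
    have key : ∀ f g : (Fin (r + 1) → ℚ) ≃ₗ[ℚ] (Fin (r + 1) → ℚ),
        (∀ v, f (shiftedWeight r t v) = g (shiftedWeight r t v)) → f = g := by
      intro f g h
      refine LinearEquiv.toLinearMap_injective (LinearMap.pi_ext' fun a => ?_)
      ext1
      have e : (Pi.single a 1 : Fin (r + 1) → ℚ) =
          shiftedWeight r t (Pi.single ((a : ℕ) : ℤ) 1) - shiftedWeight r t 0 := by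
        funext b
        simp [shiftedWeight, Pi.single_apply, Fin.ext_iff]
      simp only [LinearMap.comp_apply, LinearMap.coe_single, LinearEquiv.coe_coe]
      rw [e, map_sub, map_sub, h, h]
    exact key f g h

lemma exists_int_of_mem_rootLattice {x : Fin (r + 1) → ℚ} (hx : x ∈ (typeA r).rootLattice) :
    (∀ a, ∃ m : ℤ, x a = m) ∧ ∑ a, x a = 0 := by
  have key : ∀ x : Fin (r + 1) → ℚ, x ∈ AddSubgroup.closure
      {v : Fin (r + 1) → ℚ | ∃ a b : Fin (r + 1), a ≠ b ∧ v = Pi.single a 1 - Pi.single b 1} →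
      (∀ a, ∃ m : ℤ, x a = m) ∧ ∑ a, x a = 0 := by
    intro x hx
    induction hx using AddSubgroup.closure_induction with
    | mem x hx =>
      obtain ⟨a, b, -, rfl⟩ := hx
      refine ⟨fun c => ⟨(Pi.single a 1 - Pi.single b 1 : Fin (r + 1) → ℤ) c, ?_⟩, ?_⟩
      · simp [Pi.single_apply]
      · simp
    | zero => exact ⟨fun _ => ⟨0, by simp⟩, by simp⟩
    | add x y _ _ hx hy =>
      refine ⟨fun a => ?_, by simp [Finset.sum_add_distrib, hx.2, hy.2]⟩
      obtain ⟨m, hm⟩ := hx.1 a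
      obtain ⟨n, hn⟩ := hy.1 a
      exact ⟨m + n, by simp [hm, hn]⟩
    | neg x _ hx =>
      refine ⟨fun a => ?_, by simp [hx.2]⟩
      obtain ⟨m, hm⟩ := hx.1 a
      exact ⟨-m, by simp [hm]⟩
  exact key x hx

lemma exists_eq_shiftedWeight {t : ℚ} {x : Fin (r + 1) → ℚ} (h : ∀ a, ∃ m : ℤ, x a - t = m) :
    ∃ v : ℤ → ℤ, x = shiftedWeight r t v ∧ ∀ a ∉ Finset.Icc (0 : ℤ) r, v a = 0 := by
  choose m hm using h
  refine ⟨fun a => if ha : 0 ≤ a ∧ a.toNat < r + 1 then m ⟨a.toNat, ha.2⟩ else 0, ?_, ?_⟩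
  · funext a
    simp [shiftedWeight, ← hm, show (a : ℕ) ≤ r by omega]
  · intro a ha
    rw [Finset.mem_Icc] at ha
    exact dif_neg (by omega)

/-- The coordinates of `ℚ^{r+1}` belonging to a finite set of integers. -/
def indexSet (r : ℕ) (A : Finset ℤ) : Finset (Fin (r + 1)) :=
  Finset.univ.filter fun a => ((a : ℕ) : ℤ) ∈ A

lemma mem_indexSet {A : Finset ℤ} {a : Fin (r + 1)} : a ∈ indexSet r A ↔ ((a : ℕ) : ℤ) ∈ A := by
  simp [indexSet]

lemma sum_shiftedWeight (t : ℚ) {v : ℤ → ℤ} (hv : ∀ a ∉ Finset.Icc (0 : ℤ) r, v a = 0)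
    (A : Finset ℤ) :
    ∑ a ∈ indexSet r A, shiftedWeight r t v a =
      (∑ _a ∈ indexSet r A, t) + ((∑ a ∈ A, v a : ℤ) : ℚ) := by
  simp only [shiftedWeight]
  rw [Finset.sum_add_distrib, Int.cast_sum]
  congr 1
  refine Finset.sum_of_injOn (fun a : Fin (r + 1) => ((a : ℕ) : ℤ)) ?_ ?_ ?_ fun _ _ => rfl
  · intro a _ b _ h
    simpa [Fin.ext_iff] using h
  · intro a ha
    exact mem_indexSet.1 ha
  · intro a ha h
    rw [hv, Int.cast_zero]
    intro h'
    rw [Finset.mem_Icc] at h'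
    lift a to ℕ using h'.1
    exact h ⟨⟨a, by omega⟩, mem_indexSet.2 ha, rfl⟩

end TypeA

theorem statement1 (r : ℕ) (hr : 1 ≤ r)
    (lam mu : Fin (r + 1) → ℚ) (hlam0 : ∑ a, lam a = 0)
    (hwt : (typeA r).IsWeight lam) (hdom : (typeA r).Dominant lam)
    (l : List (Fin r)) (hl : (typeA r).Reduced l)
    (hmuwt : (typeA r).IsWeight mu)
    (hQ : lam - mu ∈ (typeA r).rootLattice)
    (hconv : mu ∈ (typeA r).demPolytope lam ((typeA r).wordProd l)) :
    0 < (typeA r).demChar l lam mu := by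
  have hι := isIntegralChart_shiftedWeight r (lam 0)
  obtain ⟨hentry, hsum⟩ := exists_int_of_mem_rootLattice hQ
  have hlam : ∀ a, ∃ m : ℤ, lam a - lam 0 = m := fun a => by
    by_cases ha : a = 0
    · exact ⟨0, by simp [ha]⟩
    · obtain ⟨m, hm⟩ := hwt _ ⟨a, 0, ha, rfl⟩
      exact ⟨m, (stdCoroot_single_sub_single ha lam).symm.trans hm⟩
  obtain ⟨v, hv, hv0⟩ := exists_eq_shiftedWeight hlam
  obtain ⟨w, hw, hw0⟩ := exists_eq_shiftedWeight (t := lam 0) (x := mu) fun a => by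
    obtain ⟨m, hm⟩ := hlam a
    obtain ⟨n, hn⟩ := hentry a
    refine ⟨m - n, ?_⟩
    rw [Int.cast_sub, ← hm, ← hn, Pi.sub_apply]
    ring
  generalize lam 0 = t at hι hv hw
  subst hv hw
  have hv' : ∀ x < r, v (x + 1) ≤ v x := fun x hx => by
    have h := (hdom (⟨x, hx⟩ : Fin r)).trans_eq (hι.coroot_apply (⟨x, hx⟩ : Fin r) v)
    exact sub_nonneg.1 (Int.cast_nonneg_iff.1 h)
  have hlt : ∀ x ∈ l.map Fin.val, x < r := by simp
  refine hι.demChar_pos hv' (coeff_intDemWord_pos (r := r) hv' hlt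
    (fun a ha => by rw [hv0 a ha, hw0 a ha]) ?_ fun A => ?_)
  · have key := fun {v} hv => sum_shiftedWeight (r := r) t (v := v) hv (Finset.Icc (0 : ℤ) r)
    have e : indexSet r (Finset.Icc (0 : ℤ) r) = Finset.univ := by
      ext a
      simp only [mem_indexSet, Finset.mem_Icc, Finset.mem_univ, iff_true]
      omega
    rw [e] at key
    simp only [Pi.sub_apply, Finset.sum_sub_distrib] at hsum
    rw [key hv0, key hw0, add_sub_add_left_eq_sub, sub_eq_zero] at hsum
    exact_mod_cast hsum.symm
  · let g : Module.Dual ℚ (Fin (r + 1) → ℚ) :=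
      ∑ a ∈ indexSet r A, LinearMap.proj a
    have hg : ∀ {v : ℤ → ℤ}, (∀ a ∉ Finset.Icc (0 : ℤ) r, v a = 0) →
        g (shiftedWeight r t v) =
          (∑ _a ∈ indexSet r A, t) + ((∑ a ∈ A, v a : ℤ) : ℚ) := by
      intro v hv
      rw [← sum_shiftedWeight t hv]
      simp [g, LinearMap.sum_apply]
    have h := RootData.le_of_mem_demPolytope (R := typeA r) g
      (B := (∑ a ∈ indexSet r A, t) +
        (rankFun v (l.map Fin.val) A : ℚ)) (fun u hu => ?_) hconv
    · have h' := (hg hw0).symm.trans_le h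
      exact_mod_cast le_of_add_le_add_left h'
    · obtain ⟨l', hl', e, hle⟩ := hι.sum_le_rankFun_of_bruhatLE hl hu hv'
      have e' := (congrArg g e).trans
        (hg fun a ha => (swapAct_of_notMem_Icc v hl' ha).trans (hv0 a ha))
      refine e'.trans_le (add_le_add_right ?_ _)
      exact_mod_cast hle A
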